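/- Let P be a simple polygon and let Q be the subpolygon of P obtained by cutting P along all nonredundant cuts of P. Then for every cut C' of the simple polygon Q, the pocket of C' (taken in P) contains the pocket Pocket(C) of at least one nonredundant cut C of P; in particular, every cut of Q is redundant when regarded as a cut of P. -/

import Mathlib

open Set

noncomputable section

/-- The Euclidean plane. -/
abbrev E2 := EuclideanSpace ℝ (Fin 2)

/-- A simple polygon in the plane, given by its cyclic sequence of vertices.
Adjacent edges meet exactly at their common vertex, and non-adjacent edges
are disjoint, so the boundary is a simple closed polygonal curve. -/
structure SimplePolygon where
  n : ℕ
  three_le : 3 ≤ n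
  vtx : ZMod n → E2
  inj : Function.Injective vtx
  adj_edges : ∀ i : ZMod n,
    segment ℝ (vtx i) (vtx (i + 1)) ∩ segment ℝ (vtx (i + 1)) (vtx (i + 2)) = {vtx (i + 1)}
  nonadj_edges : ∀ i j : ZMod n, i ≠ j → i + 1 ≠ j → j + 1 ≠ i →
    segment ℝ (vtx i) (vtx (i + 1)) ∩ segment ℝ (vtx j) (vtx (j + 1)) = ∅

namespace SimplePolygon

variable (P : SimplePolygon)

/-- The boundary `∂P`: the union of the edges. -/
def boundary : Set E2 := ⋃ i : ZMod P.n, segment ℝ (P.vtx i) (P.vtx (i + 1))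

/-- The compact region bounded by `∂P`: the boundary together with all points of the
bounded connected components of its complement. -/
def region : Set E2 :=
  P.boundary ∪ {x | x ∉ P.boundary ∧ Bornology.IsBounded (connectedComponentIn P.boundaryᶜ x)}

/-- `x` sees `y` (in `P`) if the closed segment `[x,y]` is contained in `P`. -/
def Visible (x y : E2) : Prop := segment ℝ x y ⊆ P.region

/-- The vertex `vtx i` is reflex: its internal angle is strictly larger than `π`, i.e.
near the vertex the midpoint of two points at equal small parameter along the two
incident edges lies outside the region. -/
def IsReflex (i : ZMod P.n) : Prop :=
  ∃ ε₀ > (0 : ℝ), ∀ ε ∈ Set.Ioo (0 : ℝ) ε₀,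
    midpoint ℝ (P.vtx i + ε • (P.vtx (i - 1) - P.vtx i))
               (P.vtx i + ε • (P.vtx (i + 1) - P.vtx i)) ∉ P.region

/-- `P` is star-shaped if a single point of `P` sees all of `P`. -/
def IsStarShaped : Prop := ∃ x ∈ P.region, ∀ y ∈ P.region, P.Visible x y

/-- A visibility path: a connected curve inside `P` from which every point of `P`
is visible. -/
def IsVisibilityPath (Pth : Set E2) : Prop :=
  IsConnected Pth ∧ Pth ⊆ P.region ∧ ∀ x ∈ P.region, ∃ p ∈ Pth, P.Visible x p

/-- The pocket, inside `P`, determined by a cut segment `s` on the side of the point `u`: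
the closure of the connected component of `P \ s` containing `u`, together with `s`. -/
def pocketOfSeg (s : Set E2) (u : E2) : Set E2 :=
  closure (connectedComponentIn (P.region \ s) u) ∪ s

end SimplePolygon

/-- A cut of a simple polygon `P`: for a reflex vertex `v = vtx i` with adjacent
vertex `u = vtx j`, the segment from `v` to the closest point `w` of `∂P` hit by
the ray from `v` in the direction from `u` to `v`. -/
structure SimplePolygon.Cut (P : SimplePolygon) where
  i : ZMod P.n
  j : ZMod P.n
  adj : j = i + 1 ∨ j = i - 1
  reflex : P.IsReflex i
  t : ℝ
  t_pos : 0 < t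
  hits : P.vtx i + t • (P.vtx i - P.vtx j) ∈ P.boundary
  first_hit : ∀ s ∈ Set.Ioo (0 : ℝ) t, P.vtx i + s • (P.vtx i - P.vtx j) ∉ P.boundary
  inside : segment ℝ (P.vtx i) (P.vtx i + t • (P.vtx i - P.vtx j)) ⊆ P.region

namespace SimplePolygon.Cut

variable {P : SimplePolygon} (C : P.Cut)

/-- The reflex vertex generating the cut. -/
def v : E2 := P.vtx C.i

/-- The adjacent vertex `u`; the edge `u v` is the generator of the cut. -/
def u : E2 := P.vtx C.j

/-- The other endpoint of the cut, on `∂P`. -/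
def w : E2 := P.vtx C.i + C.t • (P.vtx C.i - P.vtx C.j)

/-- The cut as a segment. -/
def seg : Set E2 := segment ℝ C.v C.w

/-- `Pocket(C)`: the part of `P` cut off by `C` that contains the generator vertex `u`. -/
def pocket : Set E2 := P.pocketOfSeg C.seg C.u

/-- A cut is redundant if the pocket of some cut is strictly contained in its pocket. -/
def Redundant : Prop := ∃ C' : P.Cut, C'.pocket ⊂ C.pocket

/-- A nonredundant (essential) cut. -/
def Nonredundant : Prop := ¬ C.Redundant

/-- `x` is a vertex of the polygon `Pocket(C)`: either the endpoint `w` of the cut, or a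
vertex of `P` belonging to the pocket. -/
def PocketVertex (x : E2) : Prop :=
  x = C.w ∨ ∃ k : ZMod P.n, P.vtx k = x ∧ x ∈ C.pocket

end SimplePolygon.Cut

/-- Length of a polygonal path given by its list of vertices. -/
def polyLength (l : List E2) : ℝ := ((l.zip l.tail).map fun p => dist p.1 p.2).sum

namespace SimplePolygon

variable (P : SimplePolygon)

/-- A polygonal path inside `P`: a nonempty list of points with each consecutive
segment contained in `P`. -/
def IsPolyPathIn (l : List E2) : Prop :=
  l ≠ [] ∧ List.Chain' (fun a b => segment ℝ a b ⊆ P.region) l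

/-- `l` is a shortest Euclidean (polygonal) path inside `P` from `x` to the set `S`. -/
def IsGeodesicTo (x : E2) (S : Set E2) (l : List E2) : Prop :=
  P.IsPolyPathIn l ∧ l.head? = some x ∧ (∃ y ∈ S, l.getLast? = some y) ∧
  ∀ m : List E2, P.IsPolyPathIn m → m.head? = some x →
    (∃ y ∈ S, m.getLast? = some y) → polyLength l ≤ polyLength m

/-- The subpolygon `Q` of `P` obtained by cutting `P` along all nonredundant cuts:
the closure of `P` minus the union of the pockets of all nonredundant cuts. -/
def core : Set E2 :=
  closure (P.region \ ⋃ C : {C : P.Cut // C.Nonredundant}, (C : P.Cut).pocket)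

end SimplePolygon

/-- The planar cross product. -/
def cross2 (a b : E2) : ℝ := a 0 * b 1 - a 1 * b 0

/-- A polygonal chain all of whose turns have the sign `s` (a convex chain bending
consistently to one side). -/
def ConvexChain (s : ℝ) (l : List E2) : Prop :=
  ∀ p q r : E2, [p, q, r] <:+: l → 0 ≤ s * cross2 (q - p) (r - q)

section Plane

theorem cross2_add_right (a b c : E2) : cross2 a (b + c) = cross2 a b + cross2 a c := by
  simp only [cross2, PiLp.add_apply]; ring

theorem cross2_sub_right (a b c : E2) : cross2 a (b - c) = cross2 a b - cross2 a c := by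
  simp only [cross2, PiLp.sub_apply]; ring

theorem cross2_neg_right (a b : E2) : cross2 a (-b) = -cross2 a b := by
  simp only [cross2, PiLp.neg_apply]; ring

theorem cross2_smul_right (a b : E2) (c : ℝ) : cross2 a (c • b) = c * cross2 a b := by
  simp only [cross2, PiLp.smul_apply, smul_eq_mul]; ring

theorem cross2_smul_left (a b : E2) (c : ℝ) : cross2 (c • a) b = c * cross2 a b := by
  simp only [cross2, PiLp.smul_apply, smul_eq_mul]; ring

theorem cross2_self (a : E2) : cross2 a a = 0 := by
  simp only [cross2]; ring

theorem cross2_swap (a b : E2) : cross2 a b = -cross2 b a := by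
  simp only [cross2]; ring

theorem continuous_cross2 (a : E2) : Continuous fun x => cross2 a x := by
  unfold cross2; fun_prop

/-- Rotation of a vector by a quarter turn. -/
def quarterTurn (d : E2) : E2 := !₂[-d 1, d 0]

theorem E2.sq_add_sq_pos {d : E2} (hd : d ≠ 0) : 0 < d 0 ^ 2 + d 1 ^ 2 := by
  by_contra h
  have h0 : d 0 = 0 := by nlinarith [sq_nonneg (d 0), sq_nonneg (d 1)]
  have h1 : d 1 = 0 := by nlinarith [sq_nonneg (d 0), sq_nonneg (d 1)]
  exact hd (by ext i; fin_cases i <;> simp [h0, h1])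

theorem cross2_quarterTurn_pos {d : E2} (hd : d ≠ 0) : 0 < cross2 d (quarterTurn d) := by
  have := E2.sq_add_sq_pos hd
  simp only [cross2, quarterTurn]
  simp
  nlinarith

theorem exists_eq_smul_of_cross2_eq_zero {d x : E2} (hd : d ≠ 0) (h : cross2 d x = 0) :
    ∃ c : ℝ, x = c • d := by
  have hp := (E2.sq_add_sq_pos hd).ne'
  refine ⟨(x 0 * d 0 + x 1 * d 1) / (d 0 ^ 2 + d 1 ^ 2), ?_⟩
  unfold cross2 at h
  ext i
  fin_cases i
  · simp only [Fin.zero_eta, PiLp.smul_apply, smul_eq_mul]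
    field_simp
    linear_combination -d 1 * h
  · simp only [Fin.mk_one, PiLp.smul_apply, smul_eq_mul]
    field_simp
    linear_combination d 0 * h

/-- The open half-plane on the side `τ` of the line through `p` with direction `d`. -/
def sideOf (τ : ℝ) (p d : E2) : Set E2 := {x | 0 < τ * cross2 d (x - p)}

theorem add_mem_sideOf {τ : ℝ} {p d y : E2} : p + y ∈ sideOf τ p d ↔ 0 < τ * cross2 d y := by
  simp only [sideOf, mem_ofPred_eq, add_sub_cancel_left]

theorem convex_sideOf (τ : ℝ) (p d : E2) : Convex ℝ (sideOf τ p d) := by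
  intro x hx y hy a b ha hb hab
  have e : a • x + b • y - p = a • (x - p) + b • (y - p) := by
    rw [smul_sub, smul_sub]
    have : p = a • p + b • p := by rw [← add_smul, hab, one_smul]
    nth_rewrite 1 [this]; abel
  simp only [sideOf, mem_ofPred_eq] at *
  rw [e, cross2_add_right, cross2_smul_right, cross2_smul_right]
  rcases ha.eq_or_lt with rfl | ha
  · have : b = 1 := by linarith
    subst this; simpa using hy
  · nlinarith [mul_pos ha hx, mul_nonneg hb hy.le]

theorem isOpen_sideOf (τ : ℝ) (p d : E2) : IsOpen (sideOf τ p d) := by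
  apply isOpen_lt continuous_const
  exact continuous_const.mul ((continuous_cross2 d).comp (continuous_id.sub continuous_const))

/-- The open sector on the side `τ` of the two-edge path that arrives at `v` in direction `d`
and leaves it in direction `e`. -/
def sector (τ : ℝ) (v d e : E2) : Set E2 :=
  if 0 < τ * cross2 d e then sideOf τ v d ∩ sideOf τ v e else sideOf τ v d ∪ sideOf τ v e

theorem sector_inter_ball_isPreconnected {τ : ℝ} (hτ : τ ≠ 0) (v : E2) {d e : E2}
    (hpar : cross2 d e = 0 → ∃ c : ℝ, 0 < c ∧ e = c • d) (r : ℝ) :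
    IsPreconnected (sector τ v d e ∩ Metric.ball v r) := by
  have cd := (convex_sideOf τ v d).inter (convex_ball v r)
  have ce := (convex_sideOf τ v e).inter (convex_ball v r)
  unfold sector
  split_ifs with h
  · exact (((convex_sideOf τ v d).inter (convex_sideOf τ v e)).inter
      (convex_ball v r)).isPreconnected
  · by_cases h0 : cross2 d e = 0
    · obtain ⟨c, hc, rfl⟩ := hpar h0
      have : sideOf τ v (c • d) = sideOf τ v d := by
        ext x
        simp only [sideOf, mem_ofPred_eq, cross2_smul_left]
        rw [mul_left_comm]
        exact mul_pos_iff_of_pos_left hc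
      rw [this, union_self]
      exact cd.isPreconnected
    · rcases le_or_gt r 0 with hr | hr
      · rw [Metric.ball_eq_empty.2 hr, inter_empty]; exact isPreconnected_empty
      rw [union_inter_distrib_right]
      have hneg : τ * cross2 d e < 0 :=
        lt_of_le_of_ne (not_lt.1 h) (mul_ne_zero hτ h0)
      set s : ℝ := r / (2 * (‖d - e‖ + 1)) with hs
      have hspos : 0 < s := by positivity
      have key : cross2 e d = - cross2 d e := cross2_swap _ _
      have hb : v + s • (d - e) ∈ Metric.ball v r := by
        rw [mem_ball_iff_norm, add_sub_cancel_left, norm_smul, Real.norm_of_nonneg hspos.le, hs,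
          div_mul_eq_mul_div, div_lt_iff₀ (by positivity)]
        nlinarith [norm_nonneg (d - e)]
      refine IsPreconnected.union (v + s • (d - e)) ⟨?_, hb⟩ ⟨?_, hb⟩ cd.isPreconnected
        ce.isPreconnected
      · rw [add_mem_sideOf, cross2_smul_right, cross2_sub_right, cross2_self]
        nlinarith
      · rw [add_mem_sideOf, cross2_smul_right, cross2_sub_right, cross2_self, key]
        nlinarith

theorem sub_smul_notMem_sector (τ : ℝ) (v d e : E2) {s : ℝ} (hs : 0 ≤ s) :
    v - s • d ∉ sector τ v d e := by
  have h2 : cross2 e d = -cross2 d e := cross2_swap _ _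
  rw [sub_eq_add_neg, ← neg_smul]
  unfold sector
  split_ifs with h
  · rintro ⟨h1, -⟩
    simp [add_mem_sideOf, cross2_neg_right, cross2_smul_right, cross2_self] at h1
  · rintro (h1 | h1)
    · simp [add_mem_sideOf, cross2_neg_right, cross2_smul_right, cross2_self] at h1
    · rw [add_mem_sideOf, cross2_smul_right, h2] at h1
      nlinarith

theorem add_smul_notMem_sector (τ : ℝ) (v d e : E2) {s : ℝ} (hs : 0 ≤ s) :
    v + s • e ∉ sector τ v d e := by
  have e1 : v + s • e - v = s • e := by abel
  unfold sector
  split_ifs with h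
  · rintro ⟨-, h1⟩
    simp [sideOf, e1, cross2_smul_right, cross2_self] at h1
  · rintro (h1 | h1)
    · simp only [sideOf, mem_ofPred_eq, e1, cross2_smul_right] at h1
      nlinarith
    · simp [sideOf, e1, cross2_smul_right, cross2_self] at h1

theorem mem_sector_of_notMem_rays {v d e x : E2} (hd : d ≠ 0) (he : e ≠ 0)
    (hpar : cross2 d e = 0 → ∃ c : ℝ, 0 < c ∧ e = c • d)
    (h1 : ∀ s : ℝ, 0 ≤ s → x ≠ v - s • d) (h2 : ∀ s : ℝ, 0 ≤ s → x ≠ v + s • e) :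
    x ∈ sector 1 v d e ∨ x ∈ sector (-1) v d e := by
  have hA : cross2 d (x - v) = 0 → ∃ c : ℝ, 0 < c ∧ x - v = c • d := by
    intro h
    obtain ⟨c, hc⟩ := exists_eq_smul_of_cross2_eq_zero hd h
    refine ⟨c, ?_, hc⟩
    by_contra hn
    refine h1 (-c) (by linarith) ?_
    rw [neg_smul, ← hc]; abel
  have hB : cross2 e (x - v) = 0 → ∃ c : ℝ, c < 0 ∧ x - v = c • e := by
    intro h
    obtain ⟨c, hc⟩ := exists_eq_smul_of_cross2_eq_zero he h
    refine ⟨c, ?_, hc⟩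
    by_contra hn
    refine h2 c (by linarith) ?_
    rw [← hc]; abel
  have sw : cross2 e d = -cross2 d e := cross2_swap _ _
  unfold sector
  rcases lt_trichotomy (cross2 d e) 0 with h | h | h
  · rw [if_neg (by linarith), if_pos (by linarith)]
    simp only [sideOf, mem_union, mem_inter_iff, mem_ofPred_eq]
    by_contra hcon
    have ha : cross2 d (x - v) ≤ 0 := by by_contra h'; exact hcon (.inl (.inl (by linarith)))
    have hb : cross2 e (x - v) ≤ 0 := by by_contra h'; exact hcon (.inl (.inr (by linarith)))
    rcases ha.eq_or_lt with ha0 | ha0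
    · obtain ⟨c, hc, hx⟩ := hA ha0
      rw [hx, cross2_smul_right, sw] at hb; nlinarith
    rcases hb.eq_or_lt with hb0 | hb0
    · obtain ⟨c, hc, hx⟩ := hB hb0
      rw [hx, cross2_smul_right] at ha; nlinarith
    exact hcon (.inr ⟨by linarith, by linarith⟩)
  · rw [if_neg (by rw [h]; simp), if_neg (by rw [h]; simp)]
    simp only [sideOf, mem_union, mem_ofPred_eq]
    rcases lt_trichotomy (cross2 d (x - v)) 0 with ha | ha | ha
    · exact .inr (.inl (by linarith))
    · obtain ⟨c, hc, hx⟩ := hA ha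
      obtain ⟨c', hc', rfl⟩ := hpar h
      refine absurd ?_ (h2 (c / c') (by positivity))
      rw [smul_smul, div_mul_cancel₀ _ hc'.ne', ← hx]; abel
    · exact .inl (.inl (by linarith))
  · rw [if_pos (by linarith), if_neg (by linarith)]
    simp only [sideOf, mem_union, mem_inter_iff, mem_ofPred_eq]
    by_contra hcon
    have ha : 0 ≤ cross2 d (x - v) := by by_contra h'; exact hcon (.inr (.inl (by linarith)))
    have hb : 0 ≤ cross2 e (x - v) := by by_contra h'; exact hcon (.inr (.inr (by linarith)))
    rcases ha.eq_or_lt with ha0 | ha0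
    · obtain ⟨c, hc, hx⟩ := hA ha0.symm
      rw [hx, cross2_smul_right, sw] at hb; nlinarith
    rcases hb.eq_or_lt with hb0 | hb0
    · obtain ⟨c, hc, hx⟩ := hB hb0.symm
      rw [hx, cross2_smul_right] at ha; nlinarith
    exact hcon (.inl ⟨by linarith, by linarith⟩)

end Plane

namespace SimplePolygon

variable (P : SimplePolygon)

instance : NeZero P.n := ⟨by have := P.three_le; omega⟩

instance : Fact (1 < P.n) := ⟨by have := P.three_le; omega⟩

/-- The `i`-th edge as a set. -/
def edge (i : ZMod P.n) : Set E2 := segment ℝ (P.vtx i) (P.vtx (i + 1))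

/-- The direction vector of the `i`-th edge. -/
def dir (i : ZMod P.n) : E2 := P.vtx (i + 1) - P.vtx i

/-- The point at parameter `t` along the `i`-th edge, displaced by `s` in the normal direction. -/
def pointNear (i : ZMod P.n) (t s : ℝ) : E2 :=
  P.vtx i + t • P.dir i + s • quarterTurn (P.dir i)

theorem dir_ne_zero (i : ZMod P.n) : P.dir i ≠ 0 := by
  intro h
  have h1 := P.inj (sub_eq_zero.1 h)
  simp at h1

theorem mem_edge_iff {i : ZMod P.n} {x : E2} :
    x ∈ P.edge i ↔ ∃ t ∈ Icc (0 : ℝ) 1, x = P.pointNear i t 0 := by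
  rw [edge, segment_eq_image']
  simp only [mem_image, pointNear, zero_smul, add_zero, dir]
  exact exists_congr fun t => and_congr_right fun _ => eq_comm

theorem isCompact_edge (i : ZMod P.n) : IsCompact (P.edge i) := by
  rw [edge, segment_eq_image']
  exact isCompact_Icc.image (by fun_prop)

theorem isClosed_edge (i : ZMod P.n) : IsClosed (P.edge i) := (P.isCompact_edge i).isClosed

theorem edge_subset_boundary (i : ZMod P.n) : P.edge i ⊆ P.boundary :=
  subset_iUnion P.edge i

theorem isClosed_boundary : IsClosed P.boundary :=
  isClosed_iUnion_of_finite P.isClosed_edge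

theorem vtx_mem_edge (i : ZMod P.n) : P.vtx i ∈ P.edge i := left_mem_segment _ _ _

theorem vtx_mem_boundary (i : ZMod P.n) : P.vtx i ∈ P.boundary :=
  P.edge_subset_boundary i (P.vtx_mem_edge i)

theorem edge_inter_edge_succ (i : ZMod P.n) : P.edge i ∩ P.edge (i + 1) = {P.vtx (i + 1)} := by
  have := P.adj_edges i
  rwa [show i + 2 = i + 1 + 1 by ring] at this

theorem vtx_succ_notMem_edge {i j : ZMod P.n} (h1 : j ≠ i) (h2 : j ≠ i + 1) :
    P.vtx (i + 1) ∉ P.edge j := by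
  intro h
  have h3 := P.vtx_mem_edge (i + 1)
  by_cases h4 : i + 1 + 1 = j
  · subst h4
    have h5 : P.vtx (i + 1) ∈ P.edge (i + 1) ∩ P.edge (i + 1 + 1) := ⟨h3, h⟩
    rw [edge_inter_edge_succ] at h5
    exact h2 (P.inj h5).symm
  · have h5 := P.nonadj_edges (i + 1) j (Ne.symm h2) h4 (by simpa using h1)
    exact eq_empty_iff_forall_notMem.1 h5 _ ⟨h3, h⟩

theorem pointNear_notMem_edge {i j : ZMod P.n} (h : j ≠ i) {t : ℝ} (ht : t ∈ Ioo (0 : ℝ) 1) :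
    P.pointNear i t 0 ∉ P.edge j := by
  intro hj
  have hi : P.pointNear i t 0 ∈ P.edge i := P.mem_edge_iff.2 ⟨t, Ioo_subset_Icc_self ht, rfl⟩
  have hd := P.dir_ne_zero i
  have aux : ∀ c : ℝ, c ≠ 0 → c • P.dir i ≠ 0 := fun c hc => smul_ne_zero hc hd
  by_cases h1 : i + 1 = j
  · subst h1
    have h5 : P.pointNear i t 0 ∈ P.edge i ∩ P.edge (i + 1) := ⟨hi, hj⟩
    rw [edge_inter_edge_succ, mem_singleton_iff] at h5
    apply aux (t - 1) (by linarith [ht.2])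
    have h6 : t • P.dir i = P.dir i := by
      nth_rewrite 2 [dir]
      rw [← h5, pointNear]
      simp
    rw [sub_smul, one_smul, h6, sub_self]
  by_cases h2 : j + 1 = i
  · subst h2
    have h5 : P.pointNear (j + 1) t 0 ∈ P.edge j ∩ P.edge (j + 1) := ⟨hj, hi⟩
    rw [edge_inter_edge_succ, mem_singleton_iff] at h5
    apply aux t ht.1.ne'
    simpa [pointNear] using h5
  · have h5 := P.nonadj_edges i j (Ne.symm h) h1 h2
    exact eq_empty_iff_forall_notMem.1 h5 _ ⟨hi, hj⟩

theorem eq_smul_dir_of_cross2_eq_zero (i : ZMod P.n) (h : cross2 (P.dir i) (P.dir (i + 1)) = 0) :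
    ∃ c : ℝ, 0 < c ∧ P.dir (i + 1) = c • P.dir i := by
  obtain ⟨c, hc⟩ := exists_eq_smul_of_cross2_eq_zero (P.dir_ne_zero i) h
  refine ⟨c, ?_, hc⟩
  by_contra hneg
  have h1c : 0 < 1 - c := by linarith
  have hmem : P.vtx (i + 1) + (1 / (1 - c)) • P.dir (i + 1) ∈ P.edge i ∩ P.edge (i + 1) := by
    constructor
    · refine P.mem_edge_iff.2 ⟨1 + c / (1 - c), ⟨?_, ?_⟩, ?_⟩
      · rw [← sub_nonneg]; field_simp; norm_num
      · have : c / (1 - c) ≤ 0 := div_nonpos_of_nonpos_of_nonneg (by linarith) h1c.le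
        linarith
      · rw [hc, pointNear, add_smul, one_smul, smul_smul, zero_smul, dir]
        rw [show 1 / (1 - c) * c = c / (1 - c) by ring]
        abel
    · refine P.mem_edge_iff.2 ⟨1 / (1 - c), ⟨by positivity, ?_⟩, by simp [pointNear]⟩
      rw [div_le_one h1c]; linarith
  rw [edge_inter_edge_succ, mem_singleton_iff, add_eq_left] at hmem
  exact smul_ne_zero (by positivity) (P.dir_ne_zero (i + 1)) hmem

theorem mem_region_of_mem_boundary {x : E2} (h : x ∈ P.boundary) : x ∈ P.region := Or.inl h

theorem notMem_boundary_of_notMem_region {x : E2} (h : x ∉ P.region) : x ∉ P.boundary :=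
  fun h' => h (Or.inl h')

theorem isBounded_component_iff {x : E2} (h : x ∉ P.boundary) :
    Bornology.IsBounded (connectedComponentIn P.boundaryᶜ x) ↔ x ∈ P.region := by
  simp [region, h]

theorem subset_compl_region_of_isPreconnected {T : Set E2} (hT : IsPreconnected T)
    (hTb : T ⊆ P.boundaryᶜ) {x : E2} (hx : x ∈ T) (hxr : x ∉ P.region) : T ⊆ P.regionᶜ := by
  intro y hy hyr
  apply hxr
  rw [← P.isBounded_component_iff (hTb hy)] at hyr
  rw [← P.isBounded_component_iff (hTb hx)]
  rwa [connectedComponentIn_eq (hT.subset_connectedComponentIn hx hTb hy)]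

theorem isClosed_region : IsClosed P.region := by
  rw [← isOpen_compl_iff, Metric.isOpen_iff]
  intro x hx
  obtain ⟨r, hr, hb⟩ := Metric.isOpen_iff.1 P.isClosed_boundary.isOpen_compl x
    (P.notMem_boundary_of_notMem_region hx)
  exact ⟨r, hr, P.subset_compl_region_of_isPreconnected (convex_ball x r).isPreconnected hb
    (Metric.mem_ball_self hr) hx⟩

theorem mem_interior_region {x : E2} (hx : x ∈ P.region) (hb : x ∉ P.boundary) :
    x ∈ interior P.region := by
  obtain ⟨r, hr, hball⟩ := Metric.isOpen_iff.1 P.isClosed_boundary.isOpen_compl x hb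
  refine mem_interior.2 ⟨Metric.ball x r, ?_, Metric.isOpen_ball, Metric.mem_ball_self hr⟩
  intro y hy
  by_contra hyr
  exact P.subset_compl_region_of_isPreconnected (convex_ball x r).isPreconnected hball hy hyr
    (Metric.mem_ball_self hr) hx

end SimplePolygon

/-- The plane as the complex numbers. -/
def E2.toComplex (x : E2) : ℂ := ⟨x 0, x 1⟩

theorem E2.continuous_toComplex : Continuous E2.toComplex := by
  have : E2.toComplex = fun x : E2 => ((x 0 : ℝ) : ℂ) + ((x 1 : ℝ) : ℂ) * Complex.I := by
    funext x; apply Complex.ext <;> simp [E2.toComplex]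
  rw [this]; fun_prop

theorem E2.toComplex_injective : Function.Injective E2.toComplex := by
  intro x y h
  have h0 := congrArg Complex.re h
  have h1 := congrArg Complex.im h
  ext i; fin_cases i
  · exact h0
  · exact h1

theorem E2.norm_toComplex (x : E2) : ‖E2.toComplex x‖ = ‖x‖ := by
  rw [EuclideanSpace.norm_eq, Complex.norm_eq_sqrt_sq_add_sq]
  simp [E2.toComplex]

/-- The ratio whose argument is the angle under which the segment from `a` to `b` is seen
from `x`. -/
def viewRatio (a b x : E2) : ℂ := (b.toComplex - x.toComplex) / (a.toComplex - x.toComplex)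

theorem viewRatio_mem_slitPlane {a b x : E2} (hx : x ∉ segment ℝ a b) :
    viewRatio a b x ∈ Complex.slitPlane := by
  have ha : a.toComplex - x.toComplex ≠ 0 := by
    intro h
    rw [← E2.toComplex_injective (sub_eq_zero.1 h)] at hx
    exact hx (left_mem_segment _ _ _)
  by_contra hcon
  rw [Complex.mem_slitPlane_iff_not_le_zero, not_not] at hcon
  obtain ⟨hre, him⟩ := Complex.le_def.1 hcon
  simp only [Complex.zero_re, Complex.zero_im] at hre him
  set c := (viewRatio a b x).re with hc
  have hq : viewRatio a b x = (c : ℂ) := by apply Complex.ext <;> simp [hc, him]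
  rw [viewRatio, div_eq_iff ha] at hq
  have hre' := congrArg Complex.re hq
  have him' := congrArg Complex.im hq
  simp [E2.toComplex] at hre' him'
  apply hx
  have h1c : 0 < 1 - c := by linarith
  refine ⟨-c / (1 - c), 1 / (1 - c), div_nonneg (by linarith) h1c.le, by positivity, ?_, ?_⟩
  · field_simp; ring
  · ext i; fin_cases i
    · simp; field_simp; linarith
    · simp; field_simp; linarith

theorem continuousAt_arg_viewRatio {a b x : E2} (hx : x ∉ segment ℝ a b) :
    ContinuousAt (fun y => (viewRatio a b y).arg) x := by
  have ha : a.toComplex - x.toComplex ≠ 0 := by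
    intro h
    rw [← E2.toComplex_injective (sub_eq_zero.1 h)] at hx
    exact hx (left_mem_segment _ _ _)
  refine (Complex.continuousAt_arg (viewRatio_mem_slitPlane hx)).comp ?_
  have := E2.continuous_toComplex
  unfold viewRatio
  exact ContinuousAt.div (by fun_prop) (by fun_prop) ha

theorem tendsto_arg_viewRatio_cobounded (a b : E2) :
    Filter.Tendsto (fun y => (viewRatio a b y).arg) (Bornology.cobounded E2) (nhds 0) := by
  have h1 : Filter.Tendsto (fun y => viewRatio a b y) (Bornology.cobounded E2) (nhds 1) := by
    have hc : Filter.Tendsto (fun y : E2 => a.toComplex - y.toComplex)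
        (Bornology.cobounded E2) (Bornology.cobounded ℂ) := by
      rw [← tendsto_norm_atTop_iff_cobounded]
      refine Filter.tendsto_atTop_mono (f := fun y : E2 => ‖y‖ - ‖a‖) ?_ ?_
      · intro y
        rw [← E2.norm_toComplex y, ← E2.norm_toComplex a, norm_sub_rev]
        exact norm_sub_norm_le _ _
      · exact Filter.tendsto_atTop_add_const_right _ _ tendsto_norm_cobounded_atTop
    have h2 : Filter.Tendsto (fun y : E2 => 1 + (b.toComplex - a.toComplex) *
        (a.toComplex - y.toComplex)⁻¹) (Bornology.cobounded E2) (nhds 1) := by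
      have := ((Filter.tendsto_inv₀_cobounded).comp hc).const_mul (b.toComplex - a.toComplex)
      simpa using this.const_add 1
    refine h2.congr' ?_
    have hne : ∀ᶠ y in Bornology.cobounded E2, a.toComplex - y.toComplex ≠ 0 :=
      hc.eventually (Bornology.eventually_ne_cobounded 0)
    filter_upwards [hne] with y hy
    rw [viewRatio]; field_simp; ring
  have h3 := (Complex.continuousAt_arg Complex.one_mem_slitPlane).tendsto.comp h1
  rwa [Complex.arg_one] at h3

namespace SimplePolygon

variable (P : SimplePolygon)

/-- The total angle swept by the boundary curve as seen from `x`. -/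
def totalAngle (x : E2) : ℝ := ∑ i, (viewRatio (P.vtx i) (P.vtx (i + 1)) x).arg

theorem continuousAt_totalAngle {x : E2} (hx : x ∉ P.boundary) :
    ContinuousAt P.totalAngle x := by
  unfold totalAngle
  refine tendsto_finsetSum _ fun i _ => continuousAt_arg_viewRatio fun h => hx ?_
  exact P.edge_subset_boundary i h

theorem exists_totalAngle_eq {x : E2} (hx : x ∉ P.boundary) :
    ∃ k : ℤ, P.totalAngle x = k * (2 * Real.pi) := by
  have hne : ∀ i, (P.vtx i).toComplex - x.toComplex ≠ 0 := by
    intro i h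
    rw [← E2.toComplex_injective (sub_eq_zero.1 h)] at hx
    exact hx (P.vtx_mem_boundary i)
  have hprod : ∏ i, viewRatio (P.vtx i) (P.vtx (i + 1)) x = 1 := by
    unfold viewRatio
    rw [Finset.prod_div_distrib, Fintype.prod_equiv (Equiv.addRight (1 : ZMod P.n))
      (fun i => (P.vtx (i + 1)).toComplex - x.toComplex)
      (fun i => (P.vtx i).toComplex - x.toComplex) (fun i => rfl)]
    exact div_self (Finset.prod_ne_zero_iff.2 fun i _ => hne i)
  have hexp : Complex.exp (P.totalAngle x * Complex.I) = 1 := by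
    have hnorm : ∏ i, ((‖viewRatio (P.vtx i) (P.vtx (i + 1)) x‖ : ℝ) : ℂ) = 1 := by
      rw [← Complex.ofReal_prod, ← norm_prod, hprod]; simp
    rw [totalAngle, Complex.ofReal_sum, Finset.sum_mul, Complex.exp_sum, ← one_mul (∏ _, _),
      ← hnorm, ← Finset.prod_mul_distrib, hnorm, ← hprod]
    exact Finset.prod_congr rfl fun i _ => Complex.norm_mul_exp_arg_mul_I _
  obtain ⟨k, hk⟩ := Complex.exp_eq_one_iff.1 hexp
  refine ⟨k, ?_⟩
  have := congrArg Complex.im hk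
  simpa using this

theorem totalAngle_eq_of_isPreconnected {T : Set E2} (hT : IsPreconnected T)
    (hTb : T ⊆ P.boundaryᶜ) {x y : E2} (hx : x ∈ T) (hy : y ∈ T) :
    P.totalAngle x = P.totalAngle y := by
  have hpi := Real.two_pi_pos
  have hc : ContinuousOn (fun z => P.totalAngle z / (2 * Real.pi)) T := fun z hz =>
    ((P.continuousAt_totalAngle (hTb hz)).div_const _).continuousWithinAt
  have hm : MapsTo (fun z => P.totalAngle z / (2 * Real.pi)) T (range ((↑) : ℤ → ℝ)) := by
    intro z hz
    obtain ⟨k, hk⟩ := P.exists_totalAngle_eq (hTb hz)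
    exact ⟨k, by simp only [hk]; field_simp⟩
  have hdisc : IsDiscrete (range ((↑) : ℤ → ℝ)) :=
    Int.isClosedEmbedding_coe_real.isEmbedding.isInducing.isDiscrete_range
  have := hT.constant_of_mapsTo hdisc hc hm hx hy
  field_simp at this
  exact this

theorem totalAngle_eq_zero_of_notMem_region {x : E2} (hx : x ∉ P.region) :
    P.totalAngle x = 0 := by
  have hxb := P.notMem_boundary_of_notMem_region hx
  have hunb : ¬ Bornology.IsBounded (connectedComponentIn P.boundaryᶜ x) := fun h =>
    hx ((P.isBounded_component_iff hxb).1 h)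
  have hlim : Filter.Tendsto P.totalAngle (Bornology.cobounded E2) (nhds 0) := by
    have := tendsto_finsetSum (Finset.univ : Finset (ZMod P.n)) fun i _ =>
      tendsto_arg_viewRatio_cobounded (P.vtx i) (P.vtx (i + 1))
    simp only [Finset.sum_const_zero] at this
    exact this
  have hev : ∀ᶠ y in Bornology.cobounded E2, P.totalAngle y ∈ Metric.ball 0 (2 * Real.pi) :=
    hlim.eventually (Metric.ball_mem_nhds _ Real.two_pi_pos)
  have : ∃ y ∈ connectedComponentIn P.boundaryᶜ x,
      P.totalAngle y ∈ Metric.ball 0 (2 * Real.pi) := by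
    by_contra hcon
    push Not at hcon
    apply hunb
    rw [Bornology.isBounded_def]
    filter_upwards [hev] with y hy hmem
    exact hcon y hmem hy
  obtain ⟨y, hy, hy2⟩ := this
  have hsub := connectedComponentIn_subset P.boundaryᶜ x
  rw [P.totalAngle_eq_of_isPreconnected isPreconnected_connectedComponentIn hsub
    (mem_connectedComponentIn hxb) hy]
  obtain ⟨k, hk⟩ := P.exists_totalAngle_eq (hsub hy)
  rw [hk, mem_ball_zero_iff, norm_mul, Real.norm_of_nonneg Real.two_pi_pos.le] at hy2
  have hk1 : |(k : ℝ)| < 1 := by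
    rw [Real.norm_eq_abs] at hy2
    nlinarith [Real.two_pi_pos]
  have hk0 : k = 0 := by
    have : |k| < 1 := by exact_mod_cast hk1
    exact Int.abs_lt_one_iff.1 this
  rw [hk, hk0]; simp

theorem continuous_pointNear (i : ZMod P.n) (t : ℝ) : Continuous fun s => P.pointNear i t s := by
  unfold pointNear; fun_prop

theorem viewRatio_pointNear (i : ZMod P.n) {t s : ℝ} (hs : s ≠ 0) :
    viewRatio (P.vtx i) (P.vtx (i + 1)) (P.pointNear i t s) =
      (⟨(s ^ 2 - t * (1 - t)) / (t ^ 2 + s ^ 2), s / (t ^ 2 + s ^ 2)⟩ : ℂ) := by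
  have hd := E2.sq_add_sq_pos (P.dir_ne_zero i)
  have hpos : 0 < t ^ 2 + s ^ 2 := by positivity
  have ha : (P.vtx i).toComplex - (P.pointNear i t s).toComplex =
      (P.dir i).toComplex * (⟨-t, -s⟩ : ℂ) := by
    apply Complex.ext <;> simp [E2.toComplex, pointNear, quarterTurn] <;> ring
  have hb : (P.vtx (i + 1)).toComplex - (P.pointNear i t s).toComplex =
      (P.dir i).toComplex * (⟨1 - t, -s⟩ : ℂ) := by
    apply Complex.ext <;> simp [E2.toComplex, pointNear, quarterTurn, dir] <;> ring
  have hdc : (P.dir i).toComplex ≠ 0 := by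
    rw [← norm_ne_zero_iff, E2.norm_toComplex]
    exact norm_ne_zero_iff.2 (P.dir_ne_zero i)
  have hne : (⟨-t, -s⟩ : ℂ) ≠ 0 := by
    intro h; have := congrArg Complex.im h; simp at this; exact hs this
  rw [viewRatio, ha, hb, mul_div_mul_left _ _ hdc, div_eq_iff hne]
  apply Complex.ext <;> simp <;> field_simp <;> ring

theorem not_eventually_both_sides_exterior (i : ZMod P.n) {t : ℝ} (ht : t ∈ Ioo (0 : ℝ) 1) :
    ¬ ∀ᶠ s in nhdsWithin (0 : ℝ) (Ioi 0),
      P.pointNear i t s ∉ P.region ∧ P.pointNear i t (-s) ∉ P.region := by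
  intro hev
  set g : E2 → ℝ := fun x =>
    ∑ j ∈ Finset.univ.erase i, (viewRatio (P.vtx j) (P.vtx (j + 1)) x).arg with hg
  have hgc : ContinuousAt g (P.pointNear i t 0) := by
    refine tendsto_finsetSum _ fun j hj => continuousAt_arg_viewRatio ?_
    exact P.pointNear_notMem_edge (Finset.ne_of_mem_erase hj) ht
  have hc0 : Filter.Tendsto (fun s => P.pointNear i t s) (nhdsWithin 0 (Ioi 0))
      (nhds (P.pointNear i t 0)) :=
    ((P.continuous_pointNear i t).tendsto 0).mono_left nhdsWithin_le_nhds
  have hc1 : Filter.Tendsto (fun s => P.pointNear i t (-s)) (nhdsWithin 0 (Ioi 0))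
      (nhds (P.pointNear i t 0)) := by
    have := (((P.continuous_pointNear i t).comp continuous_neg).tendsto 0).mono_left
      (nhdsWithin_le_nhds (s := Ioi 0))
    simp only [Function.comp_def, neg_zero] at this
    exact this
  have hdiff : Filter.Tendsto (fun s => g (P.pointNear i t s) - g (P.pointNear i t (-s)))
      (nhdsWithin 0 (Ioi 0)) (nhds 0) := by
    simpa using (hgc.tendsto.comp hc0).sub (hgc.tendsto.comp hc1)
  have hbound : ∀ᶠ s in nhdsWithin (0 : ℝ) (Ioi 0),
      g (P.pointNear i t s) - g (P.pointNear i t (-s)) ≤ -Real.pi := by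
    have hsmall : ∀ᶠ s in nhdsWithin (0 : ℝ) (Ioi 0), s ^ 2 < t * (1 - t) := by
      have : Filter.Tendsto (fun s : ℝ => s ^ 2) (nhdsWithin 0 (Ioi 0)) (nhds 0) := by
        have h := (continuous_pow 2).tendsto (0 : ℝ)
        simp only [ne_eq, OfNat.ofNat_ne_zero, not_false_eq_true, zero_pow] at h
        exact h.mono_left nhdsWithin_le_nhds
      exact this.eventually_lt_const (mul_pos ht.1 (by linarith [ht.2]))
    filter_upwards [hev, hsmall, self_mem_nhdsWithin] with s hs hss hpos
    have hpos' : (0 : ℝ) < s := hpos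
    have h1 := P.totalAngle_eq_zero_of_notMem_region hs.1
    have h2 := P.totalAngle_eq_zero_of_notMem_region hs.2
    have hsplit : ∀ x, P.totalAngle x =
        (viewRatio (P.vtx i) (P.vtx (i + 1)) x).arg + g x := fun x =>
      (Finset.add_sum_erase Finset.univ _ (Finset.mem_univ i)).symm
    rw [hsplit, P.viewRatio_pointNear i hpos'.ne'] at h1
    rw [hsplit, P.viewRatio_pointNear i (neg_ne_zero.2 hpos'.ne')] at h2
    have hden : 0 < t ^ 2 + s ^ 2 := by positivity
    have hre : (s ^ 2 - t * (1 - t)) / (t ^ 2 + s ^ 2) < 0 :=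
      div_neg_of_neg_of_pos (by linarith) hden
    have a1 : Real.pi / 2 <
        (⟨(s ^ 2 - t * (1 - t)) / (t ^ 2 + s ^ 2), s / (t ^ 2 + s ^ 2)⟩ : ℂ).arg := by
      by_contra hle
      rcases Complex.arg_le_pi_div_two_iff.1 (not_lt.1 hle) with h | h
      · exact absurd h (not_le.2 hre)
      · exact absurd h (not_lt.2 (by positivity))
    have a2 : (⟨((-s) ^ 2 - t * (1 - t)) / (t ^ 2 + (-s) ^ 2), -s / (t ^ 2 + (-s) ^ 2)⟩ : ℂ).arg
        < -(Real.pi / 2) := by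
      by_contra hle
      rcases Complex.neg_pi_div_two_le_arg_iff.1 (not_lt.1 hle) with h | h
      · simp only [neg_sq] at h
        exact absurd h (not_le.2 hre)
      · simp only [neg_sq] at h
        exact absurd h (not_le.2 (div_neg_of_neg_of_pos (by linarith) hden))
    linarith
  have := hdiff.eventually (lt_mem_nhds (show -Real.pi < 0 by linarith [Real.pi_pos]))
  obtain ⟨s, h1, h2⟩ := (hbound.and this).exists
  linarith

end SimplePolygon

namespace SimplePolygon

variable (P : SimplePolygon)

theorem cross2_dir_pointNear (i : ZMod P.n) (t s : ℝ) :
    cross2 (P.dir i) (P.pointNear i t s - P.vtx i) =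
      s * cross2 (P.dir i) (quarterTurn (P.dir i)) := by
  rw [pointNear, show P.vtx i + t • P.dir i + s • quarterTurn (P.dir i) - P.vtx i =
    t • P.dir i + s • quarterTurn (P.dir i) by abel, cross2_add_right, cross2_smul_right,
    cross2_smul_right, cross2_self]
  ring

theorem pointNear_notMem_edge_self (i : ZMod P.n) (t : ℝ) {s : ℝ} (hs : s ≠ 0) :
    P.pointNear i t s ∉ P.edge i := by
  intro h
  obtain ⟨t', -, ht'⟩ := P.mem_edge_iff.1 h
  have h1 := P.cross2_dir_pointNear i t s
  rw [ht', P.cross2_dir_pointNear, zero_mul] at h1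
  exact mul_ne_zero hs (cross2_quarterTurn_pos (P.dir_ne_zero i)).ne' h1.symm

theorem eventually_segment_pointNear_subset (i : ZMod P.n) {t₀ t₁ : ℝ}
    (h₀ : t₀ ∈ Ioo (0 : ℝ) 1) (h₁ : t₁ ∈ Ioo (0 : ℝ) 1) :
    ∀ᶠ s in nhds (0 : ℝ), s ≠ 0 →
      segment ℝ (P.pointNear i t₀ s) (P.pointNear i t₁ s) ⊆ P.boundaryᶜ := by
  have hF : IsClosed (⋃ j : {j : ZMod P.n // j ≠ i}, P.edge j) :=
    isClosed_iUnion_of_finite fun j => P.isClosed_edge j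
  have hcomb : ∀ a b s : ℝ, a + b = 1 → a • P.pointNear i t₀ s + b • P.pointNear i t₁ s =
      P.pointNear i (a * t₀ + b * t₁) s := by
    intro a b s hab
    have : a = 1 - b := by linarith
    subst this
    simp only [pointNear]
    module
  have hIoo : ∀ a b : ℝ, 0 ≤ a → 0 ≤ b → a + b = 1 → a * t₀ + b * t₁ ∈ Ioo (0 : ℝ) 1 :=
    fun a b ha hb hab => (convex_Ioo (0 : ℝ) 1) h₀ h₁ ha hb hab
  have hK : IsCompact (segment ℝ (P.pointNear i t₀ 0) (P.pointNear i t₁ 0)) := by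
    rw [segment_eq_image']
    exact isCompact_Icc.image (by fun_prop)
  have hsub : segment ℝ (P.pointNear i t₀ 0) (P.pointNear i t₁ 0) ⊆
      (⋃ j : {j : ZMod P.n // j ≠ i}, P.edge j)ᶜ := by
    rintro x ⟨a, b, ha, hb, hab, rfl⟩ hx
    rw [hcomb a b 0 hab] at hx
    obtain ⟨⟨j, hj⟩, hx⟩ := mem_iUnion.1 hx
    exact P.pointNear_notMem_edge hj (hIoo a b ha hb hab) hx
  obtain ⟨δ, hδ, hthick⟩ := hK.exists_thickening_subset_open hF.isOpen_compl hsub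
  have hev : ∀ᶠ s in nhds (0 : ℝ), ‖s • quarterTurn (P.dir i)‖ < δ := by
    have : Filter.Tendsto (fun s : ℝ => ‖s • quarterTurn (P.dir i)‖) (nhds 0) (nhds 0) := by
      have h : Continuous fun s : ℝ => ‖s • quarterTurn (P.dir i)‖ := by fun_prop
      simpa using h.tendsto 0
    exact this.eventually_lt_const hδ
  filter_upwards [hev] with s hs hs0
  rintro x ⟨a, b, ha, hb, hab, rfl⟩ hx
  rw [hcomb a b s hab] at hx
  obtain ⟨j, hj⟩ := mem_iUnion.1 hx
  by_cases hji : j = i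
  · subst hji
    exact P.pointNear_notMem_edge_self j _ hs0 hj
  · refine hthick (Metric.mem_thickening_iff.2 ⟨P.pointNear i (a * t₀ + b * t₁) 0,
      ⟨a, b, ha, hb, hab, hcomb a b 0 hab⟩, ?_⟩) (mem_iUnion.2 ⟨⟨j, hji⟩, hj⟩)
    rw [dist_eq_norm]
    simpa [pointNear] using hs

/-- The sector on the side `τ` of the boundary curve at the vertex `i + 1`. -/
def corner (τ : ℝ) (i : ZMod P.n) : Set E2 :=
  sector τ (P.vtx (i + 1)) (P.dir i) (P.dir (i + 1))

theorem exists_corner_radius (i : ZMod P.n) :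
    ∃ r > 0, ∀ τ, P.corner τ i ∩ Metric.ball (P.vtx (i + 1)) r ⊆ P.boundaryᶜ := by
  have hF : IsClosed (⋃ j : {j : ZMod P.n // j ≠ i ∧ j ≠ i + 1}, P.edge j) :=
    isClosed_iUnion_of_finite fun j => P.isClosed_edge j
  have hv : P.vtx (i + 1) ∈ (⋃ j : {j : ZMod P.n // j ≠ i ∧ j ≠ i + 1}, P.edge j)ᶜ := by
    intro h
    obtain ⟨⟨j, h1, h2⟩, hj⟩ := mem_iUnion.1 h
    exact P.vtx_succ_notMem_edge h1 h2 hj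
  obtain ⟨r, hr, hball⟩ := Metric.isOpen_iff.1 hF.isOpen_compl _ hv
  refine ⟨r, hr, fun τ x ⟨hx, hxb⟩ hb => ?_⟩
  obtain ⟨j, hj⟩ := mem_iUnion.1 hb
  by_cases h1 : j = i
  · subst h1
    obtain ⟨t, ht, rfl⟩ := P.mem_edge_iff.1 hj
    refine sub_smul_notMem_sector τ (P.vtx (j + 1)) (P.dir j) (P.dir (j + 1))
      (s := 1 - t) (by linarith [ht.2]) ?_
    have : P.vtx (j + 1) - (1 - t) • P.dir j = P.pointNear j t 0 := by
      simp only [pointNear, dir]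
      module
    rw [this]
    exact hx
  by_cases h2 : j = i + 1
  · subst h2
    obtain ⟨t, ht, rfl⟩ := P.mem_edge_iff.1 hj
    refine add_smul_notMem_sector τ (P.vtx (i + 1)) (P.dir i) (P.dir (i + 1)) ht.1 ?_
    have : P.vtx (i + 1) + t • P.dir (i + 1) = P.pointNear (i + 1) t 0 := by simp [pointNear]
    rw [this]
    exact hx
  · exact hball hxb (mem_iUnion.2 ⟨⟨j, h1, h2⟩, hj⟩)

theorem corner_inter_ball_isPreconnected {τ : ℝ} (hτ : τ ≠ 0) (i : ZMod P.n) (r : ℝ) :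
    IsPreconnected (P.corner τ i ∩ Metric.ball (P.vtx (i + 1)) r) :=
  sector_inter_ball_isPreconnected hτ _ (P.eq_smul_dir_of_cross2_eq_zero i) r

theorem mem_sector_of_mem {τ : ℝ} {v d e x : E2} (h1 : x ∈ sideOf τ v d)
    (h2 : 0 < τ * cross2 d e → x ∈ sideOf τ v e) : x ∈ sector τ v d e := by
  unfold sector
  split_ifs with h
  · exact ⟨h1, h2 h⟩
  · exact .inl h1

theorem mem_sector_of_mem' {τ : ℝ} {v d e x : E2} (h1 : x ∈ sideOf τ v e)
    (h2 : 0 < τ * cross2 d e → x ∈ sideOf τ v d) : x ∈ sector τ v d e := by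
  unfold sector
  split_ifs with h
  · exact ⟨h2 h, h1⟩
  · exact .inr h1

theorem eventually_pos_of_pos {f : ℝ → ℝ} (hf : Continuous f) (h0 : 0 < f 0) :
    ∀ᶠ s in nhdsWithin (0 : ℝ) (Ioi 0), 0 < f s :=
  nhdsWithin_le_nhds ((hf.tendsto 0).eventually_const_lt h0)

theorem eventually_pointNear_mem_corner {τ : ℝ} (hτ : τ ≠ 0) (i : ZMod P.n) {r t : ℝ}
    (ht : t < 1) (hr : (1 - t) * ‖P.dir i‖ < r) :
    ∀ᶠ s in nhdsWithin (0 : ℝ) (Ioi 0),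
      P.pointNear i t (τ * s) ∈ P.corner τ i ∩ Metric.ball (P.vtx (i + 1)) r := by
  have hx : ∀ s, P.pointNear i t (τ * s) =
      P.vtx (i + 1) + ((-(1 - t)) • P.dir i + (τ * s) • quarterTurn (P.dir i)) := by
    intro s; simp only [pointNear, dir]; module
  have sw : cross2 (P.dir (i + 1)) (P.dir i) = -cross2 (P.dir i) (P.dir (i + 1)) :=
    cross2_swap _ _
  have hq := cross2_quarterTurn_pos (P.dir_ne_zero i)
  have h1 : ∀ᶠ s in nhdsWithin (0 : ℝ) (Ioi 0), 0 <
      r - ‖(-(1 - t)) • P.dir i + (τ * s) • quarterTurn (P.dir i)‖ := by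
    refine eventually_pos_of_pos (by fun_prop) ?_
    simp only [mul_zero, zero_smul, add_zero, norm_smul, norm_neg]
    rw [Real.norm_of_nonneg (by linarith)]; linarith
  have h2 : ∀ᶠ s in nhdsWithin (0 : ℝ) (Ioi 0), 0 < τ * cross2 (P.dir i) (P.dir (i + 1)) →
      0 < τ * cross2 (P.dir (i + 1)) ((-(1 - t)) • P.dir i + (τ * s) • quarterTurn (P.dir i)) := by
    by_cases h : 0 < τ * cross2 (P.dir i) (P.dir (i + 1))
    · simp only [h, true_imp_iff]
      refine eventually_pos_of_pos
        (f := fun s => τ * cross2 (P.dir (i + 1))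
          ((-(1 - t)) • P.dir i + (τ * s) • quarterTurn (P.dir i)))
        (continuous_const.mul ((continuous_cross2 _).comp (by fun_prop))) ?_
      simp only [mul_zero, zero_smul, add_zero, cross2_smul_right, sw]
      nlinarith
    · simp only [h, false_imp_iff, Filter.eventually_true]
  filter_upwards [h1, h2, self_mem_nhdsWithin] with s hs1 hs2 hs
  have hs' : (0 : ℝ) < s := hs
  rw [hx]
  constructor
  · refine mem_sector_of_mem (add_mem_sideOf.2 ?_) fun h => add_mem_sideOf.2 (hs2 h)
    rw [cross2_add_right, cross2_smul_right, cross2_smul_right, cross2_self]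
    have : 0 < τ ^ 2 := by positivity
    have := mul_pos (mul_pos this hs') hq
    nlinarith
  · rw [mem_ball_iff_norm, add_sub_cancel_left]; linarith

theorem eventually_pointNear_succ_mem_corner {τ : ℝ} (hτ : τ ≠ 0) (i : ZMod P.n) {r t : ℝ}
    (ht : 0 < t) (hr : t * ‖P.dir (i + 1)‖ < r) :
    ∀ᶠ s in nhdsWithin (0 : ℝ) (Ioi 0),
      P.pointNear (i + 1) t (τ * s) ∈ P.corner τ i ∩ Metric.ball (P.vtx (i + 1)) r := by
  have hx : ∀ s, P.pointNear (i + 1) t (τ * s) =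
      P.vtx (i + 1) + (t • P.dir (i + 1) + (τ * s) • quarterTurn (P.dir (i + 1))) := by
    intro s; simp only [pointNear]; module
  have hq := cross2_quarterTurn_pos (P.dir_ne_zero (i + 1))
  have h1 : ∀ᶠ s in nhdsWithin (0 : ℝ) (Ioi 0), 0 <
      r - ‖t • P.dir (i + 1) + (τ * s) • quarterTurn (P.dir (i + 1))‖ := by
    refine eventually_pos_of_pos (by fun_prop) ?_
    simp only [mul_zero, zero_smul, add_zero, norm_smul]
    rw [Real.norm_of_nonneg (by linarith)]; linarith
  have h2 : ∀ᶠ s in nhdsWithin (0 : ℝ) (Ioi 0), 0 < τ * cross2 (P.dir i) (P.dir (i + 1)) →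
      0 < τ * cross2 (P.dir i) (t • P.dir (i + 1) + (τ * s) • quarterTurn (P.dir (i + 1))) := by
    by_cases h : 0 < τ * cross2 (P.dir i) (P.dir (i + 1))
    · simp only [h, true_imp_iff]
      refine eventually_pos_of_pos
        (f := fun s => τ * cross2 (P.dir i)
          (t • P.dir (i + 1) + (τ * s) • quarterTurn (P.dir (i + 1))))
        (continuous_const.mul ((continuous_cross2 _).comp (by fun_prop))) ?_
      simp only [mul_zero, zero_smul, add_zero, cross2_smul_right]
      nlinarith
    · simp only [h, false_imp_iff, Filter.eventually_true]
  filter_upwards [h1, h2, self_mem_nhdsWithin] with s hs1 hs2 hs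
  have hs' : (0 : ℝ) < s := hs
  rw [hx]
  constructor
  · refine mem_sector_of_mem' (add_mem_sideOf.2 ?_) fun h => add_mem_sideOf.2 (hs2 h)
    rw [cross2_add_right, cross2_smul_right, cross2_smul_right, cross2_self]
    have : 0 < τ ^ 2 := by positivity
    have := mul_pos (mul_pos this hs') hq
    nlinarith
  · rw [mem_ball_iff_norm, add_sub_cancel_left]; linarith

theorem exists_mem_Ioo_mul_lt {r : ℝ} (hr : 0 < r) (c : ℝ) (hc : 0 ≤ c) :
    ∃ t ∈ Ioo (0 : ℝ) 1, t * c < r := by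
  refine ⟨min (1 / 2) (r / (2 * (c + 1))), ⟨by positivity, ?_⟩, ?_⟩
  · exact (min_le_left _ _).trans_lt (by norm_num)
  · calc _ ≤ r / (2 * (c + 1)) * c := by gcongr; exact min_le_right _ _
      _ < r := by rw [div_mul_eq_mul_div, div_lt_iff₀ (by positivity)]; nlinarith

theorem tendsto_const_mul_nhdsWithin (τ : ℝ) :
    Filter.Tendsto (fun s => τ * s) (nhdsWithin (0 : ℝ) (Ioi 0)) (nhds 0) := by
  have h : Continuous fun s : ℝ => τ * s := by fun_prop
  simpa using (h.tendsto 0).mono_left (nhdsWithin_le_nhds (s := Ioi 0))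

theorem eventually_pointNear_iff {τ : ℝ} (hτ : τ ≠ 0) (i : ZMod P.n) {t₀ t₁ : ℝ}
    (h₀ : t₀ ∈ Ioo (0 : ℝ) 1) (h₁ : t₁ ∈ Ioo (0 : ℝ) 1) :
    ∀ᶠ s in nhdsWithin (0 : ℝ) (Ioi 0),
      P.pointNear i t₀ (τ * s) ∉ P.region → P.pointNear i t₁ (τ * s) ∉ P.region := by
  filter_upwards [(tendsto_const_mul_nhdsWithin τ).eventually
    (P.eventually_segment_pointNear_subset i h₀ h₁), self_mem_nhdsWithin] with s hs hpos h
  exact P.subset_compl_region_of_isPreconnected (convex_segment _ _).isPreconnected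
    (hs (mul_ne_zero hτ (ne_of_gt hpos))) (left_mem_segment _ _ _) h (right_mem_segment _ _ _)

theorem forall_of_forall_succ {n : ℕ} [NeZero n] {p : ZMod n → Prop} {i : ZMod n} (hi : p i)
    (hs : ∀ j, p j → p (j + 1)) (j : ZMod n) : p j := by
  have : ∀ k : ℕ, p (i + k) := by
    intro k
    induction k with
    | zero => simpa using hi
    | succ k ih => have := hs _ ih; rwa [add_assoc, ← Nat.cast_succ] at this
  have h := this (j - i).val
  rwa [ZMod.natCast_zmod_val, add_sub_cancel] at h

theorem exists_vtx_add_smul_notMem_region :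
    ∃ (i : ZMod P.n) (e : E2), ∀ s : ℝ, 0 < s → P.vtx (i + 1) + s • e ∉ P.region ∧
      (∀ c : ℝ, 0 ≤ c → P.vtx (i + 1) + s • e ≠ P.vtx (i + 1) - c • P.dir i) ∧
      ∀ c : ℝ, 0 ≤ c → P.vtx (i + 1) + s • e ≠ P.vtx (i + 1) + c • P.dir (i + 1) := by
  obtain ⟨m, hm⟩ := Finite.exists_max fun i => P.vtx i 0
  obtain ⟨i, rfl⟩ : ∃ i, m = i + 1 := ⟨m - 1, by ring⟩
  set H : Set E2 := {x | P.vtx (i + 1) 0 < x 0} with hH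
  have hHc : Convex ℝ H := by
    intro x hx y hy a b ha hb hab
    exact (convex_Ioi (P.vtx (i + 1) 0)) hx hy ha hb hab
  have hHb : H ⊆ P.boundaryᶜ := by
    intro x hx hxb
    obtain ⟨j, a, b, ha, hb, hab, rfl⟩ := mem_iUnion.1 hxb
    have h1 := hm j
    have h2 := hm (j + 1)
    have h3 : P.vtx (i + 1) 0 < a * P.vtx j 0 + b * P.vtx (j + 1) 0 := hx
    obtain rfl : b = 1 - a := by linarith
    nlinarith [mul_le_mul_of_nonneg_left h1 ha, mul_le_mul_of_nonneg_left h2 hb]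
  have hHunb : ∀ x ∈ H, x ∉ P.region := by
    intro x hx hxr
    rw [← P.isBounded_component_iff (hHb hx)] at hxr
    have hHbd := hxr.subset (hHc.isPreconnected.subset_connectedComponentIn hx hHb)
    obtain ⟨C, hC⟩ := hHbd.exists_norm_le
    have hy : (!₂[|C| + |P.vtx (i + 1) 0| + 1, 0] : E2) ∈ H := by
      have h1 := le_abs_self (P.vtx (i + 1) 0)
      have h2 := abs_nonneg C
      simp only [hH, mem_ofPred_eq]
      simp only [Matrix.cons_val_zero]
      linarith
    have h1 := hC _ hy
    have h2 := PiLp.norm_apply_le (!₂[|C| + |P.vtx (i + 1) 0| + 1, 0] : E2) 0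
    simp only [Matrix.cons_val_zero] at h2
    rw [Real.norm_of_nonneg (by positivity)] at h2
    linarith [le_abs_self C, abs_nonneg (P.vtx (i + 1) 0)]
  refine ⟨i, !₂[1, 0], fun s hs => ⟨hHunb _ ?_, fun c hc h => ?_, fun c hc h => ?_⟩⟩
  · simp [hH, hs]
  · have h1 := congrArg (fun x : E2 => x 0) h
    have h2 := hm i
    simp [dir] at h1 h2
    nlinarith
  · have h1 := congrArg (fun x : E2 => x 0) h
    have h2 := hm (i + 1 + 1)
    simp [dir] at h1 h2
    nlinarith

/-- One side of the boundary curve is inside the region, and the other side is outside. -/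
theorem exists_orientation : ∃ σ : ℝ, σ ≠ 0 ∧ ∀ i, ∃ r > 0,
    P.corner σ i ∩ Metric.ball (P.vtx (i + 1)) r ⊆ P.region ∧
    P.corner (-σ) i ∩ Metric.ball (P.vtx (i + 1)) r ⊆ P.regionᶜ := by
  choose r hr hrb using P.exists_corner_radius
  have sat : ∀ τ ≠ 0, ∀ i x, x ∈ P.corner τ i ∩ Metric.ball (P.vtx (i + 1)) (r i) →
      x ∉ P.region → P.corner τ i ∩ Metric.ball (P.vtx (i + 1)) (r i) ⊆ P.regionᶜ :=
    fun τ hτ i x hx hxr => P.subset_compl_region_of_isPreconnected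
      (P.corner_inter_ball_isPreconnected hτ i (r i)) (hrb i τ) hx hxr
  have step : ∀ τ ≠ 0, ∀ i, P.corner τ i ∩ Metric.ball (P.vtx (i + 1)) (r i) ⊆ P.regionᶜ →
      P.corner τ (i + 1) ∩ Metric.ball (P.vtx (i + 1 + 1)) (r (i + 1)) ⊆ P.regionᶜ := by
    intro τ hτ i h
    obtain ⟨t₀, h₀, hr₀⟩ := exists_mem_Ioo_mul_lt (hr i) ‖P.dir (i + 1)‖ (norm_nonneg _)
    obtain ⟨t₁, h₁, hr₁⟩ := exists_mem_Ioo_mul_lt (hr (i + 1)) ‖P.dir (i + 1)‖ (norm_nonneg _)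
    have h₁' : 1 - t₁ ∈ Ioo (0 : ℝ) 1 := ⟨by linarith [h₁.2], by linarith [h₁.1]⟩
    obtain ⟨s, hs1, hs2, hs3⟩ := ((P.eventually_pointNear_succ_mem_corner hτ i h₀.1 hr₀).and
      ((P.eventually_pointNear_mem_corner hτ (i + 1) h₁'.2 (by simpa using hr₁)).and
      (P.eventually_pointNear_iff hτ (i + 1) h₀ h₁'))).exists
    exact sat τ hτ _ _ hs2 (hs3 (h hs1))
  have all : ∀ τ ≠ 0, ∀ i j, P.corner τ i ∩ Metric.ball (P.vtx (i + 1)) (r i) ⊆ P.regionᶜ →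
      P.corner τ j ∩ Metric.ball (P.vtx (j + 1)) (r j) ⊆ P.regionᶜ :=
    fun τ hτ i j h => forall_of_forall_succ
      (p := fun k => P.corner τ k ∩ Metric.ball (P.vtx (k + 1)) (r k) ⊆ P.regionᶜ) h
      (step τ hτ) j
  have excl : ∀ i, P.corner 1 i ∩ Metric.ball (P.vtx (i + 1)) (r i) ⊆ P.regionᶜ →
      P.corner (-1) i ∩ Metric.ball (P.vtx (i + 1)) (r i) ⊆ P.regionᶜ → False := by
    intro i h1 h2
    obtain ⟨t, ht, hrt⟩ := exists_mem_Ioo_mul_lt (hr i) ‖P.dir i‖ (norm_nonneg _)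
    have ht' : 1 - t ∈ Ioo (0 : ℝ) 1 := ⟨by linarith [ht.2], by linarith [ht.1]⟩
    refine P.not_eventually_both_sides_exterior i ht' ?_
    filter_upwards [P.eventually_pointNear_mem_corner one_ne_zero i ht'.2 (by simpa using hrt),
      P.eventually_pointNear_mem_corner (neg_ne_zero.2 one_ne_zero) i ht'.2
        (by simpa using hrt)] with s hs1 hs2
    rw [one_mul] at hs1
    rw [neg_one_mul] at hs2
    exact ⟨h1 hs1, h2 hs2⟩
  obtain ⟨i₀, e, he⟩ := P.exists_vtx_add_smul_notMem_region
  obtain ⟨s, hs, hse⟩ := exists_mem_Ioo_mul_lt (hr i₀) ‖e‖ (norm_nonneg _)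
  have hball : P.vtx (i₀ + 1) + s • e ∈ Metric.ball (P.vtx (i₀ + 1)) (r i₀) := by
    rw [mem_ball_iff_norm, add_sub_cancel_left, norm_smul, Real.norm_of_nonneg hs.1.le]
    exact hse
  have conclude : ∀ σ : ℝ, σ ≠ 0 → (∀ i, ¬ P.corner σ i ∩ Metric.ball (P.vtx (i + 1)) (r i) ⊆
      P.regionᶜ) → (∀ i, P.corner (-σ) i ∩ Metric.ball (P.vtx (i + 1)) (r i) ⊆ P.regionᶜ) →
      ∃ σ : ℝ, σ ≠ 0 ∧ ∀ i, ∃ r > 0,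
        P.corner σ i ∩ Metric.ball (P.vtx (i + 1)) r ⊆ P.region ∧
        P.corner (-σ) i ∩ Metric.ball (P.vtx (i + 1)) r ⊆ P.regionᶜ := by
    refine fun σ hσ h1 h2 => ⟨σ, hσ, fun i => ⟨r i, hr i, fun x hx => ?_, h2 i⟩⟩
    by_contra hxr
    exact h1 i (sat σ hσ i x hx hxr)
  obtain ⟨h0, hd, he'⟩ := he s hs.1
  rcases mem_sector_of_notMem_rays (P.dir_ne_zero i₀) (P.dir_ne_zero (i₀ + 1))
    (P.eq_smul_dir_of_cross2_eq_zero i₀) hd he' with h | h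
  · have hall := fun j => all 1 one_ne_zero i₀ j (sat 1 one_ne_zero i₀ _ ⟨h, hball⟩ h0)
    exact conclude (-1) (by norm_num) (fun i hi => excl i (hall i) hi) (by simpa using hall)
  · have hall := fun j => all (-1) (by norm_num) i₀ j
      (sat (-1) (by norm_num) i₀ _ ⟨h, hball⟩ h0)
    exact conclude 1 one_ne_zero (fun i hi => excl i hi (hall i)) hall

theorem boundary_inter_interior_region : P.boundary ∩ interior P.region = ∅ := by
  rw [eq_empty_iff_forall_notMem]
  rintro x ⟨hxb, hxi⟩
  obtain ⟨i, hi⟩ := mem_iUnion.1 hxb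
  obtain ⟨t, ht, rfl⟩ := P.mem_edge_iff.1 hi
  obtain ⟨t₁, ht₁, hx₁⟩ : ∃ t₁ ∈ Ioo (0 : ℝ) 1, P.pointNear i t₁ 0 ∈ interior P.region := by
    have hc : Continuous fun t => P.pointNear i t 0 := by unfold pointNear; fun_prop
    have hcl : t ∈ closure (Ioo (0 : ℝ) 1) := by rwa [closure_Ioo (by norm_num)]
    obtain ⟨t₁, h1, h2⟩ := mem_closure_iff.1 hcl _ (isOpen_interior.preimage hc) hxi
    exact ⟨t₁, h2, h1⟩
  obtain ⟨σ, hσ, h⟩ := P.exists_orientation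
  obtain ⟨r, hr, -, hout⟩ := h i
  obtain ⟨t₀, h₀, hr₀⟩ := exists_mem_Ioo_mul_lt hr ‖P.dir i‖ (norm_nonneg _)
  have h₀' : 1 - t₀ ∈ Ioo (0 : ℝ) 1 := ⟨by linarith [h₀.2], by linarith [h₀.1]⟩
  have hin : ∀ᶠ s in nhdsWithin (0 : ℝ) (Ioi 0), P.pointNear i t₁ (-σ * s) ∈ P.region := by
    have h1 := (((P.continuous_pointNear i t₁).tendsto 0).comp
      (tendsto_const_mul_nhdsWithin (-σ))).eventually (isOpen_interior.mem_nhds hx₁)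
    filter_upwards [h1] with s hs
    exact interior_subset hs
  obtain ⟨s, h1, h2, h3⟩ := (hin.and ((P.eventually_pointNear_mem_corner (neg_ne_zero.2 hσ) i
    h₀'.2 (by simpa using hr₀)).and
    (P.eventually_pointNear_iff (neg_ne_zero.2 hσ) i h₀' ht₁))).exists
  exact h3 (hout h2) h1

end SimplePolygon

section HalfDisc

theorem sideOf_neg_neg (τ : ℝ) (p d : E2) : sideOf (-τ) p (-d) = sideOf τ p d := by
  ext x
  simp only [sideOf, mem_ofPred_eq]
  rw [← neg_one_smul ℝ d, cross2_smul_left]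
  ring_nf

theorem mem_segment_add_smul_iff {v d x : E2} {t : ℝ} (ht : 0 < t) :
    x ∈ segment ℝ v (v + t • d) ↔ ∃ s ∈ Icc (0 : ℝ) t, x = v + s • d := by
  rw [segment_eq_image']
  constructor
  · rintro ⟨a, ⟨h0, h1⟩, rfl⟩
    refine ⟨a * t, ⟨by positivity, by nlinarith⟩, ?_⟩
    simp only [add_sub_cancel_left, smul_smul]
  · rintro ⟨s, ⟨h0, h1⟩, rfl⟩
    refine ⟨s / t, ⟨by positivity, by rwa [div_le_one ht]⟩, ?_⟩
    simp only [add_sub_cancel_left, smul_smul, div_mul_cancel₀ _ ht.ne']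

theorem isCompact_segment (a b : E2) : IsCompact (segment ℝ a b) := by
  rw [segment_eq_image']
  exact isCompact_Icc.image (by fun_prop)

theorem tendsto_add_smul (x e : E2) :
    Filter.Tendsto (fun s : ℝ => x + s • e) (nhdsWithin (0 : ℝ) (Ioi 0)) (nhds x) := by
  have h : Continuous fun s : ℝ => x + s • e := by fun_prop
  simpa using (h.tendsto 0).mono_left (nhdsWithin_le_nhds (s := Ioi 0))

theorem add_smul_notMem_segment {v d y : E2} {t s : ℝ} (ht : 0 < t) (hy : cross2 d y ≠ 0) :
    v + s • d + y ∉ segment ℝ v (v + t • d) := by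
  rw [mem_segment_add_smul_iff ht]
  rintro ⟨a, -, h⟩
  apply hy
  have : y = (a - s) • d := by
    rw [add_assoc] at h
    have := add_left_cancel h
    rw [sub_smul, ← this]; abel
  rw [this, cross2_smul_right, cross2_self, mul_zero]

theorem sideOf_disjoint_segment {τ : ℝ} {v d : E2} {t : ℝ} (ht : 0 < t) :
    Disjoint (sideOf τ v d) (segment ℝ v (v + t • d)) := by
  rw [Set.disjoint_left]
  intro x hx hxs
  obtain ⟨s, -, rfl⟩ := (mem_segment_add_smul_iff ht).1 hxs
  rw [add_mem_sideOf, cross2_smul_right, cross2_self] at hx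
  simp at hx

variable {K : Set E2} {v u : E2} {t τ r : ℝ}

theorem sub_smul_mem_component (hd : v - u ≠ 0) (ht : 0 < t)
    (hL : ∀ s ∈ Ioc (0 : ℝ) 1, v - s • (v - u) ∈ K) {s : ℝ} (hs : s ∈ Ioc (0 : ℝ) 1) :
    v - s • (v - u) ∈ connectedComponentIn (K \ segment ℝ v (v + t • (v - u))) u := by
  have hpre : IsPreconnected ((fun s : ℝ => v - s • (v - u)) '' Ioc (0 : ℝ) 1) :=
    isPreconnected_Ioc.image _ (by fun_prop)
  refine hpre.subset_connectedComponentIn (x := u) ⟨1, by simp, by simp⟩ ?_ (mem_image_of_mem _ hs)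
  rintro _ ⟨a, ha, rfl⟩
  refine ⟨hL a ha, fun h => ?_⟩
  obtain ⟨b, hb, hab⟩ := (mem_segment_add_smul_iff ht).1 h
  have h0 : (a + b) • (v - u) = 0 := by
    have : (a + b) • (v - u) = (v + b • (v - u)) - (v - a • (v - u)) := by module
    rw [this, ← hab, sub_self]
  rcases smul_eq_zero.1 h0 with h0 | h0
  · linarith [ha.1, hb.1]
  · exact hd h0

/-- A half disc at `v` on one side of the line `uv` lies in the component of `u`. -/
theorem halfDisc_subset_component (hd : v - u ≠ 0) (ht : 0 < t)
    (hL : ∀ s ∈ Ioc (0 : ℝ) 1, v - s • (v - u) ∈ K) (hτ : τ ≠ 0) (hr : 0 < r)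
    (hH : sideOf τ v (v - u) ∩ Metric.ball v r ⊆ K) :
    sideOf τ v (v - u) ∩ Metric.ball v r ⊆
      connectedComponentIn (K \ segment ℝ v (v + t • (v - u))) u := by
  set d := v - u with hddef
  set H := sideOf τ v d ∩ Metric.ball v r with hHdef
  have hHsub : H ⊆ K \ segment ℝ v (v + t • d) := fun x hx =>
    ⟨hH hx, Set.disjoint_left.1 (sideOf_disjoint_segment ht) hx.1⟩
  obtain ⟨s, hs, hsr⟩ := SimplePolygon.exists_mem_Ioo_mul_lt hr ‖d‖ (norm_nonneg _)
  have hq := cross2_quarterTurn_pos hd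
  have he : v - s • d ∈ closure H := by
    refine mem_closure_of_tendsto (tendsto_add_smul (v - s • d) (τ • quarterTurn d)) ?_
    have hball : ∀ᶠ a in nhdsWithin (0 : ℝ) (Ioi 0),
        v - s • d + a • τ • quarterTurn d ∈ Metric.ball v r := by
      refine (tendsto_add_smul (v - s • d) (τ • quarterTurn d)).eventually
        (Metric.isOpen_ball.mem_nhds ?_)
      rw [mem_ball_iff_norm, show v - s • d - v = -(s • d) by abel, norm_neg, norm_smul,
        Real.norm_of_nonneg hs.1.le]
      exact hsr
    filter_upwards [hball, self_mem_nhdsWithin] with a ha ha0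
    refine ⟨?_, ha⟩
    have ha0' : (0 : ℝ) < a := ha0
    rw [show v - s • d + a • τ • quarterTurn d = v + ((-s) • d + (a * τ) • quarterTurn d) by module,
      add_mem_sideOf, cross2_add_right, cross2_smul_right, cross2_smul_right, cross2_self]
    have : 0 < τ ^ 2 := by positivity
    have := mul_pos (mul_pos ha0' this) hq
    nlinarith
  have hmem := sub_smul_mem_component hd ht hL ⟨hs.1, hs.2.le⟩
  have hpre : IsPreconnected (insert (v - s • d) H) :=
    ((convex_sideOf τ v d).inter (convex_ball v r)).isPreconnected.subset_closure
      (subset_insert _ _) (insert_subset he subset_closure)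
  rw [connectedComponentIn_eq hmem]
  refine (subset_insert _ _).trans (hpre.subset_connectedComponentIn (mem_insert _ _) ?_)
  exact insert_subset (connectedComponentIn_subset _ _ hmem) hHsub

/-- The cut segment lies in the closure of the component of `u`. -/
theorem segment_subset_closure_component (hd : v - u ≠ 0) (ht : 0 < t)
    (hL : ∀ s ∈ Ioc (0 : ℝ) 1, v - s • (v - u) ∈ K) (hτ : τ ≠ 0) (hr : 0 < r)
    (hH : sideOf τ v (v - u) ∩ Metric.ball v r ⊆ K)
    (hI : ∀ s ∈ Ioo (0 : ℝ) t, v + s • (v - u) ∈ interior K) :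
    segment ℝ v (v + t • (v - u)) ⊆
      closure (connectedComponentIn (K \ segment ℝ v (v + t • (v - u))) u) := by
  have hHA := halfDisc_subset_component hd ht hL hτ hr hH
  set d := v - u with hddef
  set A := connectedComponentIn (K \ segment ℝ v (v + t • d)) u with hA
  have hq := cross2_quarterTurn_pos hd
  have key : ∀ s ∈ Ioo (0 : ℝ) t, v + s • d ∈ closure A := by
    intro s hs
    obtain ⟨a, ha, har⟩ := SimplePolygon.exists_mem_Ioo_mul_lt hr ‖s • d‖ (norm_nonneg _)
    have has : 0 < a * s := mul_pos ha.1 hs.1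
    have has' : a * s < s := by nlinarith [ha.2, hs.1]
    have hsub : segment ℝ (v + (a * s) • d) (v + s • d) ⊆ interior K := by
      rintro x ⟨b, c, hb, hc, hbc, rfl⟩
      have : b • (v + (a * s) • d) + c • (v + s • d) = v + (b * (a * s) + c * s) • d := by
        obtain rfl : c = 1 - b := by linarith
        module
      rw [this]
      refine hI _ ((convex_Ioo (0 : ℝ) t) ⟨has, has'.trans hs.2⟩ hs hb hc hbc)
    obtain ⟨δ, hδ, hthick⟩ := (isCompact_segment _ _).exists_thickening_subset_open
      isOpen_interior hsub
    refine mem_closure_of_tendsto (tendsto_add_smul (v + s • d) (τ • quarterTurn d)) ?_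
    have h1 : ∀ᶠ b in nhdsWithin (0 : ℝ) (Ioi 0),
        v + (a * s) • d + b • τ • quarterTurn d ∈ Metric.ball v r := by
      refine (tendsto_add_smul (v + (a * s) • d) (τ • quarterTurn d)).eventually
        (Metric.isOpen_ball.mem_nhds ?_)
      rw [mem_ball_iff_norm, add_sub_cancel_left, mul_smul, norm_smul,
        Real.norm_of_nonneg ha.1.le]
      exact har
    have h2 : ∀ᶠ b in nhdsWithin (0 : ℝ) (Ioi 0),
        (0 : E2) + b • τ • quarterTurn d ∈ Metric.ball 0 δ :=
      (tendsto_add_smul 0 (τ • quarterTurn d)).eventually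
        (Metric.isOpen_ball.mem_nhds (Metric.mem_ball_self hδ))
    filter_upwards [h1, h2, self_mem_nhdsWithin] with b hb1 hb2 hb0
    have hb0' : (0 : ℝ) < b := hb0
    have hpos : 0 < τ * cross2 d (b • τ • quarterTurn d) := by
      rw [cross2_smul_right, cross2_smul_right]
      have : 0 < τ ^ 2 := by positivity
      have := mul_pos (mul_pos hb0' this) hq
      nlinarith
    have hstart : v + (a * s) • d + b • τ • quarterTurn d ∈ A := by
      refine hHA ⟨?_, hb1⟩
      rw [add_assoc, add_mem_sideOf, cross2_add_right, cross2_smul_right, cross2_self]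
      linarith
    have hpre : IsPreconnected (segment ℝ (v + (a * s) • d + b • τ • quarterTurn d)
        (v + s • d + b • τ • quarterTurn d)) := (convex_segment _ _).isPreconnected
    rw [hA, connectedComponentIn_eq hstart]
    refine hpre.subset_connectedComponentIn (left_mem_segment _ _ _) ?_ (right_mem_segment _ _ _)
    rintro x ⟨e, f, he, hf, hef, rfl⟩
    have heq : e • (v + (a * s) • d + b • τ • quarterTurn d) +
        f • (v + s • d + b • τ • quarterTurn d) =
        (e • (v + (a * s) • d) + f • (v + s • d)) + b • τ • quarterTurn d := by
      obtain rfl : f = 1 - e := by linarith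
      module
    constructor
    · rw [heq]
      refine interior_subset (hthick (Metric.mem_thickening_iff.2
        ⟨_, ⟨e, f, he, hf, hef, rfl⟩, ?_⟩))
      rw [dist_eq_norm, add_sub_cancel_left]
      simpa using hb2
    · rw [heq, show e • (v + (a * s) • d) + f • (v + s • d) =
        v + (e * (a * s) + f * s) • d by
          obtain rfl : f = 1 - e := by linarith
          module]
      refine add_smul_notMem_segment ht fun h => ?_
      rw [h] at hpos
      simp at hpos
  intro x hx
  obtain ⟨s, hs, rfl⟩ := (mem_segment_add_smul_iff ht).1 hx
  rw [← closure_Ioo ht.ne] at hs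
  have hc : Continuous fun s : ℝ => v + s • d := by fun_prop
  have := image_closure_subset_closure_image hc (mem_image_of_mem _ hs)
  refine closure_minimal ?_ isClosed_closure this
  rintro _ ⟨s, hs, rfl⟩
  exact key s hs

end HalfDisc

namespace SimplePolygon

variable (P : SimplePolygon)

theorem midpoint_edges (k : ZMod P.n) (ε : ℝ) :
    midpoint ℝ (P.vtx (k + 1) + ε • (P.vtx (k + 1 - 1) - P.vtx (k + 1)))
      (P.vtx (k + 1) + ε • (P.vtx (k + 1 + 1) - P.vtx (k + 1))) =
      P.vtx (k + 1) + ε • ((1 / 2 : ℝ) • (P.dir (k + 1) - P.dir k)) := by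
  rw [add_sub_cancel_right, midpoint_eq_smul_add]
  simp only [dir, invOf_eq_inv]
  module

theorem isReflex_iff_eventually (k : ZMod P.n) :
    P.IsReflex (k + 1) ↔ ∀ᶠ ε in nhdsWithin (0 : ℝ) (Ioi 0),
      P.vtx (k + 1) + ε • ((1 / 2 : ℝ) • (P.dir (k + 1) - P.dir k)) ∉ P.region := by
  simp only [IsReflex, midpoint_edges]
  constructor
  · rintro ⟨ε₀, h0, h⟩
    exact Filter.eventually_of_mem (Ioo_mem_nhdsGT h0) h
  · intro h
    obtain ⟨ε₀, h0, h⟩ := mem_nhdsGT_iff_exists_Ioo_subset.1 h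
    exact ⟨ε₀, h0, fun ε hε => h hε⟩

theorem eventually_add_smul_mem_ball (x e : E2) {r : ℝ} (hr : 0 < r) :
    ∀ᶠ s in nhdsWithin (0 : ℝ) (Ioi 0), x + s • e ∈ Metric.ball x r :=
  (tendsto_add_smul x e).eventually (Metric.ball_mem_nhds x hr)

theorem eventually_add_smul_dir_mem_edge (k : ZMod P.n) (c : ℝ) (hc : 0 ≤ c) :
    ∀ᶠ s in nhdsWithin (0 : ℝ) (Ioi 0), P.vtx k + s • c • P.dir k ∈ P.edge k := by
  have h1 : ∀ᶠ s in nhdsWithin (0 : ℝ) (Ioi 0), 0 < 1 - s * c :=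
    eventually_pos_of_pos (f := fun s => 1 - s * c) (by fun_prop) (by simp)
  filter_upwards [h1, self_mem_nhdsWithin] with s hs hs0
  have hs0' : (0 : ℝ) < s := hs0
  refine P.mem_edge_iff.2 ⟨s * c, ⟨by positivity, by linarith⟩, ?_⟩
  simp only [pointNear]
  module

theorem eventually_sub_smul_dir_mem_edge (k : ZMod P.n) (c : ℝ) (hc : 0 ≤ c) :
    ∀ᶠ s in nhdsWithin (0 : ℝ) (Ioi 0), P.vtx (k + 1) - s • c • P.dir k ∈ P.edge k := by
  have h1 : ∀ᶠ s in nhdsWithin (0 : ℝ) (Ioi 0), 0 < 1 - s * c :=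
    eventually_pos_of_pos (f := fun s => 1 - s * c) (by fun_prop) (by simp)
  filter_upwards [h1, self_mem_nhdsWithin] with s hs hs0
  have hs0' : (0 : ℝ) < s := hs0
  refine P.mem_edge_iff.2 ⟨1 - s * c, ⟨by linarith, by nlinarith⟩, ?_⟩
  simp only [pointNear, dir]
  module

theorem eventually_bisector_mem_corner {τ : ℝ} (k : ZMod P.n) {r : ℝ} (hr : 0 < r)
    (h : 0 < τ * cross2 (P.dir k) (P.dir (k + 1))) :
    ∀ᶠ ε in nhdsWithin (0 : ℝ) (Ioi 0),
      P.vtx (k + 1) + ε • ((1 / 2 : ℝ) • (P.dir (k + 1) - P.dir k)) ∈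
        P.corner τ k ∩ Metric.ball (P.vtx (k + 1)) r := by
  filter_upwards [eventually_add_smul_mem_ball (P.vtx (k + 1))
    ((1 / 2 : ℝ) • (P.dir (k + 1) - P.dir k)) hr, self_mem_nhdsWithin] with ε hε hε0
  have hε0' : (0 : ℝ) < ε := hε0
  have hpos := mul_pos hε0' h
  refine ⟨mem_sector_of_mem (add_mem_sideOf.2 ?_) fun _ => add_mem_sideOf.2 ?_, hε⟩
  · rw [cross2_smul_right, cross2_smul_right, cross2_sub_right, cross2_self]
    nlinarith
  · rw [cross2_smul_right, cross2_smul_right, cross2_sub_right, cross2_self,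
      cross2_swap (P.dir (k + 1))]
    nlinarith

theorem orientation_mul_cross2_neg_of_isReflex {σ : ℝ} (hσ : σ ≠ 0) {k : ZMod P.n} {r : ℝ}
    (hr : 0 < r) (hin : P.corner σ k ∩ Metric.ball (P.vtx (k + 1)) r ⊆ P.region)
    (h : P.IsReflex (k + 1)) : σ * cross2 (P.dir k) (P.dir (k + 1)) < 0 := by
  rw [isReflex_iff_eventually] at h
  by_contra hcon
  rcases (not_lt.1 hcon).eq_or_lt with h0 | h0
  · have hc0 : cross2 (P.dir k) (P.dir (k + 1)) = 0 := by
      rcases mul_eq_zero.1 h0.symm with h' | h'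
      · exact absurd h' hσ
      · exact h'
    obtain ⟨c, hc, hdir⟩ := P.eq_smul_dir_of_cross2_eq_zero k hc0
    rcases le_total 1 c with h1 | h1
    · obtain ⟨s, hs1, hs2⟩ := (h.and (P.eventually_add_smul_dir_mem_edge (k + 1)
        ((c - 1) / (2 * c)) (div_nonneg (by linarith) (by linarith)))).exists
      refine hs1 (P.mem_region_of_mem_boundary (P.edge_subset_boundary (k + 1) ?_))
      have : P.vtx (k + 1) + s • (1 / 2 : ℝ) • (P.dir (k + 1) - P.dir k) =
          P.vtx (k + 1) + s • ((c - 1) / (2 * c)) • P.dir (k + 1) := by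
        rw [hdir, smul_smul ((c - 1) / (2 * c)),
          show (c - 1) / (2 * c) * c = (c - 1) / 2 by field_simp]
        module
      rwa [this]
    · obtain ⟨s, hs1, hs2⟩ := (h.and (P.eventually_sub_smul_dir_mem_edge k
        ((1 - c) / 2) (div_nonneg (by linarith) (by linarith)))).exists
      refine hs1 (P.mem_region_of_mem_boundary (P.edge_subset_boundary k ?_))
      have : P.vtx (k + 1) + s • (1 / 2 : ℝ) • (P.dir (k + 1) - P.dir k) =
          P.vtx (k + 1) - s • ((1 - c) / 2) • P.dir k := by
        rw [hdir]; module
      rwa [this]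
  · obtain ⟨s, hs1, hs2⟩ := (h.and (P.eventually_bisector_mem_corner k hr h0)).exists
    exact hs1 (hin hs2)

theorem exists_halfDisc_subset_region {i j : ZMod P.n} (hij : j = i + 1 ∨ j = i - 1)
    (h : P.IsReflex i) :
    ∃ τ : ℝ, τ ≠ 0 ∧ ∃ r > 0,
      sideOf τ (P.vtx i) (P.vtx i - P.vtx j) ∩ Metric.ball (P.vtx i) r ⊆ P.region := by
  obtain ⟨k, rfl⟩ : ∃ k, i = k + 1 := ⟨i - 1, by ring⟩
  obtain ⟨σ, hσ, hor⟩ := P.exists_orientation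
  obtain ⟨r, hr, hin, -⟩ := hor k
  have hneg := P.orientation_mul_cross2_neg_of_isReflex hσ hr hin h
  rcases hij with rfl | rfl
  · refine ⟨-σ, neg_ne_zero.2 hσ, r, hr, fun x hx => hin ⟨?_, hx.2⟩⟩
    rw [← neg_sub, sideOf_neg_neg] at hx
    exact mem_sector_of_mem' hx.1 fun h => absurd h hneg.not_gt
  · refine ⟨σ, hσ, r, hr, fun x hx => hin ⟨?_, hx.2⟩⟩
    rw [add_sub_cancel_right] at hx
    exact mem_sector_of_mem hx.1 fun h => absurd h hneg.not_gt

theorem isReflex_of_eventually_mem_interior {i j : ZMod P.n} (hij : j = i + 1 ∨ j = i - 1)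
    (h : ∀ᶠ s in nhdsWithin (0 : ℝ) (Ioi 0),
      P.vtx i + s • (P.vtx i - P.vtx j) ∈ interior P.region) : P.IsReflex i := by
  obtain ⟨k, rfl⟩ : ∃ k, i = k + 1 := ⟨i - 1, by ring⟩
  obtain ⟨σ, hσ, hor⟩ := P.exists_orientation
  obtain ⟨r, hr, -, hout⟩ := hor k
  have hnb : ∀ x ∈ interior P.region, x ∉ P.boundary := fun x hx hb =>
    (P.boundary_inter_interior_region ▸ (⟨hb, hx⟩ : x ∈ P.boundary ∩ interior P.region) :
      x ∈ (∅ : Set E2))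
  have hneg : σ * cross2 (P.dir k) (P.dir (k + 1)) < 0 := by
    by_contra hcon
    rcases (not_lt.1 hcon).eq_or_lt with h0 | h0
    · have hc0 : cross2 (P.dir k) (P.dir (k + 1)) = 0 := by
        rcases mul_eq_zero.1 h0.symm with h' | h'
        · exact absurd h' hσ
        · exact h'
      obtain ⟨c, hc, hdir⟩ := P.eq_smul_dir_of_cross2_eq_zero k hc0
      rcases hij with rfl | rfl
      · obtain ⟨s, hs1, hs2⟩ := (h.and (P.eventually_sub_smul_dir_mem_edge k c hc.le)).exists
        refine hnb _ hs1 (P.edge_subset_boundary k ?_)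
        have : P.vtx (k + 1) + s • (P.vtx (k + 1) - P.vtx (k + 1 + 1)) =
            P.vtx (k + 1) - s • c • P.dir k := by
          rw [← hdir]; simp only [dir]; module
        rwa [this]
      · obtain ⟨s, hs1, hs2⟩ := (h.and (P.eventually_add_smul_dir_mem_edge (k + 1) c⁻¹
          (by positivity))).exists
        refine hnb _ hs1 (P.edge_subset_boundary (k + 1) ?_)
        have : P.vtx (k + 1) + s • (P.vtx (k + 1) - P.vtx (k + 1 - 1)) =
            P.vtx (k + 1) + s • c⁻¹ • P.dir (k + 1) := by
          rw [hdir, smul_smul c⁻¹, inv_mul_cancel₀ hc.ne', one_smul, add_sub_cancel_right]; rfl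
        rwa [this]
    · obtain ⟨s, ⟨hs1, hs2⟩, hs0⟩ := ((h.and (eventually_add_smul_mem_ball (P.vtx (k + 1))
        (P.vtx (k + 1) - P.vtx j) hr)).and self_mem_nhdsWithin).exists
      have hs0' : (0 : ℝ) < s := hs0
      have hpos := mul_pos hs0' h0
      refine hout ⟨?_, hs2⟩ (interior_subset hs1)
      rcases hij with rfl | rfl
      · refine mem_sector_of_mem (add_mem_sideOf.2 ?_) fun h => by linarith
        rw [← neg_sub, cross2_smul_right, cross2_neg_right]
        change 0 < -σ * (s * -cross2 (P.dir k) (P.dir (k + 1)))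
        nlinarith
      · refine mem_sector_of_mem' (add_mem_sideOf.2 ?_) fun h => by linarith
        rw [add_sub_cancel_right, cross2_smul_right, cross2_swap]
        change 0 < -σ * (s * -cross2 (P.dir k) (P.dir (k + 1)))
        nlinarith
  rw [isReflex_iff_eventually]
  filter_upwards [P.eventually_bisector_mem_corner k hr
    (τ := -σ) (by linarith)] with ε hε
  exact hout hε

end SimplePolygon

namespace SimplePolygon

variable (P : SimplePolygon)

theorem notMem_boundary_of_mem_interior {x : E2} (hx : x ∈ interior P.region) :
    x ∉ P.boundary := fun hb => by
  have : x ∈ P.boundary ∩ interior P.region := ⟨hb, hx⟩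
  rw [P.boundary_inter_interior_region] at this
  exact this

theorem core_subset_region : P.core ⊆ P.region :=
  closure_minimal sdiff_subset P.isClosed_region

namespace Cut

variable {P} (C : P.Cut)

/-- The component of the cut polygon that contains the generator vertex. -/
def side : Set E2 := connectedComponentIn (P.region \ C.seg) C.u

theorem v_sub_u_ne_zero : C.v - C.u ≠ 0 := by
  intro h
  have hij : C.i = C.j := P.inj (sub_eq_zero.1 h)
  rcases C.adj with h' | h'
  · exact one_ne_zero (α := ZMod P.n) (by linear_combination -hij - h')
  · exact one_ne_zero (α := ZMod P.n) (by linear_combination hij + h')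

theorem seg_eq : C.seg = segment ℝ C.v (C.v + C.t • (C.v - C.u)) := rfl

theorem w_eq : C.w = C.v + C.t • (C.v - C.u) := rfl

theorem isClosed_seg : IsClosed C.seg := (isCompact_segment _ _).isClosed

theorem seg_subset_region : C.seg ⊆ P.region := C.inside

theorem v_mem_boundary : C.v ∈ P.boundary := P.vtx_mem_boundary _

theorem w_mem_boundary : C.w ∈ P.boundary := C.hits

theorem mem_seg_iff {x : E2} : x ∈ C.seg ↔ ∃ s ∈ Icc (0 : ℝ) C.t, x = C.v + s • (C.v - C.u) :=
  mem_segment_add_smul_iff C.t_pos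

theorem add_smul_mem_interior {s : ℝ} (hs : s ∈ Ioo (0 : ℝ) C.t) :
    C.v + s • (C.v - C.u) ∈ interior P.region :=
  P.mem_interior_region (C.inside (C.mem_seg_iff.2 ⟨s, ⟨hs.1.le, hs.2.le⟩, rfl⟩))
    (C.first_hit s hs)

theorem sub_smul_mem_boundary {s : ℝ} (hs : s ∈ Ioc (0 : ℝ) 1) :
    C.v - s • (C.v - C.u) ∈ P.boundary := by
  have hmem : C.v - s • (C.v - C.u) ∈ segment ℝ C.v C.u := by
    rw [segment_eq_image']
    refine ⟨s, ⟨hs.1.le, hs.2⟩, ?_⟩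
    module
  unfold v u at *
  rcases C.adj with h | h <;> rw [h] at hmem ⊢
  · exact P.edge_subset_boundary _ hmem
  · rw [segment_symm] at hmem
    refine P.edge_subset_boundary (C.i - 1) ?_
    rwa [edge, sub_add_cancel]

variable {K : Set E2}

theorem sub_smul_mem_component_of_subset (hK : P.region ⊆ K) {s : ℝ} (hs : s ∈ Ioc (0 : ℝ) 1) :
    C.v - s • (C.v - C.u) ∈ connectedComponentIn (K \ C.seg) C.u :=
  sub_smul_mem_component C.v_sub_u_ne_zero C.t_pos
    (fun _ hs => hK (P.mem_region_of_mem_boundary (C.sub_smul_mem_boundary hs))) hs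

theorem seg_subset_closure_component (hK : P.region ⊆ K) :
    C.seg ⊆ closure (connectedComponentIn (K \ C.seg) C.u) := by
  obtain ⟨τ, hτ, r, hr, hH⟩ := P.exists_halfDisc_subset_region C.adj C.reflex
  exact segment_subset_closure_component C.v_sub_u_ne_zero C.t_pos
    (fun _ hs => hK (P.mem_region_of_mem_boundary (C.sub_smul_mem_boundary hs))) hτ hr
    (hH.trans hK) fun _ hs => interior_mono hK (C.add_smul_mem_interior hs)

theorem component_inter_interior_nonempty (hK : P.region ⊆ K) :
    (connectedComponentIn (K \ C.seg) C.u ∩ interior P.region).Nonempty := by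
  obtain ⟨τ, hτ, r, hr, hH⟩ := P.exists_halfDisc_subset_region C.adj C.reflex
  have hsub := halfDisc_subset_component C.v_sub_u_ne_zero C.t_pos
    (fun _ hs => hK (P.mem_region_of_mem_boundary (C.sub_smul_mem_boundary hs))) hτ hr
    (hH.trans hK)
  have hinter := ((isOpen_sideOf τ C.v (C.v - C.u)).inter Metric.isOpen_ball).subset_interior_iff.2 hH
  obtain ⟨s, hs, hs0⟩ := ((eventually_add_smul_mem_ball C.v
    (τ • quarterTurn (C.v - C.u)) hr).and self_mem_nhdsWithin).exists
  have hs0' : (0 : ℝ) < s := hs0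
  have hmem : C.v + s • τ • quarterTurn (C.v - C.u) ∈
      sideOf τ C.v (C.v - C.u) ∩ Metric.ball C.v r := by
    refine ⟨add_mem_sideOf.2 ?_, hs⟩
    rw [cross2_smul_right, cross2_smul_right]
    have : 0 < τ ^ 2 := by positivity
    have := mul_pos (mul_pos hs0' this) (cross2_quarterTurn_pos C.v_sub_u_ne_zero)
    nlinarith
  exact ⟨_, hsub hmem, hinter hmem⟩

theorem pocket_eq : C.pocket = closure C.side :=
  union_eq_left.2 (C.seg_subset_closure_component subset_rfl)

theorem isClosed_pocket : IsClosed C.pocket := by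
  rw [pocket_eq]; exact isClosed_closure

theorem seg_subset_pocket : C.seg ⊆ C.pocket := subset_union_right

theorem side_subset_pocket : C.side ⊆ C.pocket := subset_closure.trans subset_union_left

theorem eq_of_vertices_eq {C₁ C₂ : P.Cut} (hi : C₁.i = C₂.i) (hj : C₁.j = C₂.j) : C₁ = C₂ := by
  have ht : C₁.t = C₂.t := by
    rcases lt_trichotomy C₁.t C₂.t with h | h | h
    · exact absurd (hi ▸ hj ▸ C₁.hits) (C₂.first_hit _ ⟨C₁.t_pos, h⟩)
    · exact h
    · exact absurd (hi ▸ hj ▸ C₂.hits) (C₁.first_hit _ ⟨C₂.t_pos, h⟩)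
  cases C₁
  cases C₂
  simp only at hi hj ht
  subst hi hj ht
  rfl

instance : Finite P.Cut :=
  Finite.of_injective (fun C : P.Cut => (C.i, C.j)) fun _ _ h =>
    eq_of_vertices_eq (congrArg Prod.fst h) (congrArg Prod.snd h)

theorem exists_nonredundant_pocket_subset :
    ∃ C₀ : P.Cut, C₀.Nonredundant ∧ C₀.pocket ⊆ C.pocket := by
  obtain ⟨C₀, h0, hmin⟩ := Set.Finite.exists_minimalFor (fun D : P.Cut => D.pocket)
    {D : P.Cut | D.pocket ⊆ C.pocket} (Set.toFinite _) ⟨C, Subset.refl C.pocket⟩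
  refine ⟨C₀, fun ⟨D, hD⟩ => ?_, h0⟩
  exact hD.2 (hmin (hD.1.trans h0) hD.1)

theorem ball_subset_side {x y : E2} {r : ℝ}
    (hball : Metric.ball x r ⊆ P.region \ C.seg) (hy : y ∈ Metric.ball x r) (hys : y ∈ C.side) :
    Metric.ball x r ⊆ C.side := by
  unfold side at *
  rw [connectedComponentIn_eq hys]
  exact (convex_ball x r).isPreconnected.subset_connectedComponentIn hy hball

variable {C}

theorem notMem_pocket_of_mem_interior_core (hC : C.Nonredundant) {x : E2}
    (hx : x ∈ interior P.core) : x ∉ C.pocket := by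
  intro hxp
  rw [pocket_eq] at hxp
  obtain ⟨y, hyi, hys⟩ := mem_closure_iff.1 hxp _ isOpen_interior hx
  have hyn : y ∉ C.seg := (connectedComponentIn_subset _ _ hys).2
  obtain ⟨r, hr, hball⟩ := Metric.isOpen_iff.1
    (isOpen_interior.inter C.isClosed_seg.isOpen_compl) y ⟨hyi, hyn⟩
  have hsub := C.ball_subset_side (fun z hz =>
    ⟨P.core_subset_region (interior_subset (hball hz).1), (hball hz).2⟩)
    (Metric.mem_ball_self hr) hys
  obtain ⟨z, hz, hzn⟩ := mem_closure_iff.1 (interior_subset hyi) _ Metric.isOpen_ball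
    (Metric.mem_ball_self hr)
  exact hzn.2 (mem_iUnion.2 ⟨⟨C, hC⟩, C.side_subset_pocket (hsub hz)⟩)

end Cut

theorem mem_boundary_or_mem_seg_of_mem_boundary_core {R : SimplePolygon}
    (hR : R.region = P.core) {x : E2} (hx : x ∈ R.boundary) :
    x ∈ P.boundary ∨ ∃ C : P.Cut, C.Nonredundant ∧ x ∈ C.seg := by
  by_contra! hcon
  obtain ⟨hxb, hxs⟩ := hcon
  have hxc : x ∈ P.core := hR ▸ R.mem_region_of_mem_boundary hx
  have hxi := P.mem_interior_region (P.core_subset_region hxc) hxb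
  set U : Set E2 := ⋃ C : {C : P.Cut // C.Nonredundant}, (C : P.Cut).pocket with hU
  have hUc : IsClosed U := isClosed_iUnion_of_finite fun C => C.1.isClosed_pocket
  have hxU : x ∉ U := by
    intro h
    obtain ⟨⟨C, hC⟩, hxC⟩ := mem_iUnion.1 h
    obtain ⟨r, hr, hball⟩ := Metric.isOpen_iff.1
      (isOpen_interior.inter C.isClosed_seg.isOpen_compl) x ⟨hxi, hxs C hC⟩
    rw [Cut.pocket_eq] at hxC
    obtain ⟨y, hyb, hys⟩ := mem_closure_iff.1 hxC _ Metric.isOpen_ball (Metric.mem_ball_self hr)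
    have hsub := C.ball_subset_side (fun z hz =>
      ⟨interior_subset (hball hz).1, (hball hz).2⟩) hyb hys
    obtain ⟨z, hz, hzn⟩ := mem_closure_iff.1 hxc _ Metric.isOpen_ball (Metric.mem_ball_self hr)
    exact hzn.2 (mem_iUnion.2 ⟨⟨C, hC⟩, C.side_subset_pocket (hsub hz)⟩)
  refine R.notMem_boundary_of_mem_interior ?_ hx
  rw [hR]
  refine mem_interior.2 ⟨interior P.region ∩ Uᶜ, fun z hz => ?_,
    isOpen_interior.inter hUc.isOpen_compl, hxi, hxU⟩
  exact subset_closure ⟨interior_subset hz.1, hz.2⟩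

section CoreCut

variable {P} {R : SimplePolygon}

theorem coreCut_seg_disjoint_side (hR : R.region = P.core) (C' : R.Cut) {C : P.Cut}
    (hC : C.Nonredundant) : Disjoint C'.seg C.side := by
  rw [Set.disjoint_left]
  intro x hx hxs
  have hxn : x ∉ C.seg := (connectedComponentIn_subset _ _ hxs).2
  obtain ⟨r, hr, hball⟩ := Metric.isOpen_iff.1 C.isClosed_seg.isOpen_compl x hxn
  obtain ⟨s, hs, rfl⟩ := C'.mem_seg_iff.1 hx
  have hc : Continuous fun s : ℝ => C'.v + s • (C'.v - C'.u) := by fun_prop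
  rw [← closure_Ioo C'.t_pos.ne] at hs
  obtain ⟨a, haball, ha⟩ := mem_closure_iff.1 hs _ (Metric.isOpen_ball.preimage hc)
    (Metric.mem_ball_self hr)
  have hai := C'.add_smul_mem_interior ha
  have hamem : C'.v + a • (C'.v - C'.u) ∈ C'.seg :=
    C'.mem_seg_iff.2 ⟨a, ⟨ha.1.le, ha.2.le⟩, rfl⟩
  rw [hR] at hai
  refine Cut.notMem_pocket_of_mem_interior_core hC hai (C.side_subset_pocket ?_)
  unfold Cut.side at *
  rw [connectedComponentIn_eq hxs]
  refine (convex_segment _ _).isPreconnected.subset_connectedComponentIn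
    (left_mem_segment _ _ _) ?_ (right_mem_segment _ _ _)
  intro z hz
  refine ⟨P.core_subset_region (hR ▸ C'.seg_subset_region
    ((convex_segment _ _).segment_subset hx hamem hz)), ?_⟩
  exact hball ((convex_ball _ _).segment_subset (Metric.mem_ball_self hr) haball hz)

theorem pocket_ssubset_of_meets (hR : R.region = P.core) (C' : R.Cut) {C : P.Cut}
    (hC : C.Nonredundant) {x : E2} (hx : x ∈ C.seg)
    (hx' : x ∈ connectedComponentIn (P.region \ C'.seg) C'.u) :
    C.pocket ⊂ P.pocketOfSeg C'.seg C'.u := by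
  have hRP : R.region ⊆ P.region := hR ▸ P.core_subset_region
  set A := connectedComponentIn (P.region \ C'.seg) C'.u with hA
  have hpre : IsPreconnected (C.side ∪ C.seg \ C'.seg) :=
    isPreconnected_connectedComponentIn.subset_closure subset_union_left
      (union_subset subset_closure
        (sdiff_subset.trans (C.seg_subset_closure_component subset_rfl)))
  have hsub : C.side ∪ C.seg \ C'.seg ⊆ A := by
    rw [hA, connectedComponentIn_eq hx']
    refine hpre.subset_connectedComponentIn
      (.inr ⟨hx, (connectedComponentIn_subset _ _ hx').2⟩) (union_subset ?_ ?_)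
    · exact fun z hz => ⟨(connectedComponentIn_subset _ _ hz).1, fun h =>
        Set.disjoint_left.1 (coreCut_seg_disjoint_side hR C' hC) h hz⟩
    · exact sdiff_subset_sdiff_left C.seg_subset_region
  refine ⟨?_, fun h => ?_⟩
  · rw [Cut.pocket_eq]
    exact (closure_mono (subset_union_left.trans hsub)).trans subset_union_left
  · obtain ⟨z, hz, hzi⟩ := C'.component_inter_interior_nonempty hRP
    rw [hR] at hzi
    exact Cut.notMem_pocket_of_mem_interior_core hC hzi (h (.inl (subset_closure hz)))

end CoreCut

end SimplePolygon

/-- A disc with a radius removed is connected. -/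
theorem isPreconnected_ball_diff_segment {v d : E2} {t r : ℝ} (hd : d ≠ 0) (ht : 0 < t)
    (hr : 0 < r) (hrt : r ≤ t * ‖d‖) :
    IsPreconnected (Metric.ball (v + t • d) r \ segment ℝ v (v + t • d)) := by
  set w := v + t • d with hw
  have hq := cross2_quarterTurn_pos hd
  have hqd : cross2 (quarterTurn d) d = -cross2 d (quarterTurn d) := cross2_swap _ _
  have hconv : ∀ τ e, IsPreconnected (sideOf τ w e ∩ Metric.ball w r) := fun τ e =>
    ((convex_sideOf τ w e).inter (convex_ball w r)).isPreconnected
  have hcommon : ∀ τ ≠ (0 : ℝ), ∃ x, x ∈ sideOf τ w d ∩ Metric.ball w r ∧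
      x ∈ sideOf (-1) w (quarterTurn d) ∩ Metric.ball w r := by
    intro τ hτ
    obtain ⟨s, hs, hs0⟩ := ((SimplePolygon.eventually_add_smul_mem_ball w
      (d + τ • quarterTurn d) hr).and self_mem_nhdsWithin).exists
    have hs0' : (0 : ℝ) < s := hs0
    have hτ2 : 0 < τ ^ 2 := by positivity
    refine ⟨_, ⟨add_mem_sideOf.2 ?_, hs⟩, add_mem_sideOf.2 ?_, hs⟩
    · rw [cross2_smul_right, cross2_add_right, cross2_smul_right, cross2_self]
      nlinarith [mul_pos (mul_pos hs0' hτ2) hq]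
    · rw [cross2_smul_right, cross2_add_right, cross2_smul_right, cross2_self, hqd]
      nlinarith [mul_pos hs0' hq]
  have heq : Metric.ball w r \ segment ℝ v w =
      sideOf 1 w d ∩ Metric.ball w r ∪ (sideOf (-1) w (quarterTurn d) ∩ Metric.ball w r) ∪
        sideOf (-1) w d ∩ Metric.ball w r := by
    ext x
    constructor
    · rintro ⟨hxb, hxs⟩
      simp only [sideOf, mem_union, mem_inter_iff, mem_ofPred_eq, hxb, and_true]
      rcases lt_trichotomy (cross2 d (x - w)) 0 with h | h | h
      · right; linarith
      · left; right
        obtain ⟨c, hc⟩ := exists_eq_smul_of_cross2_eq_zero hd h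
        rw [hc, cross2_smul_right, hqd]
        have hc0 : 0 < c := by
          by_contra hn
          refine hxs ((mem_segment_add_smul_iff ht).2 ⟨t + c, ⟨?_, by linarith⟩, ?_⟩)
          · rw [mem_ball_iff_norm, hc, norm_smul, Real.norm_of_nonpos (by linarith)] at hxb
            have h2 := lt_of_mul_lt_mul_right (hxb.trans_le hrt) (norm_nonneg d)
            linarith
          · rw [eq_add_of_sub_eq hc, hw]; module
        nlinarith
      · left; left; linarith
    · intro hx
      refine ⟨?_, fun hxs => ?_⟩
      · rcases hx with (hx | hx) | hx <;> exact hx.2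
      · obtain ⟨s, hs, rfl⟩ := (mem_segment_add_smul_iff ht).1 hxs
        rw [show v + s • d = w + (s - t) • d by rw [hw]; module] at hx
        simp only [mem_union, mem_inter_iff, add_mem_sideOf, cross2_smul_right, cross2_self,
          hqd] at hx
        have := mul_nonneg (sub_nonneg.2 hs.2) hq.le
        rcases hx with (hx | hx) | hx <;> nlinarith [hx.1]
  rw [heq]
  obtain ⟨x, hx1, hx2⟩ := hcommon 1 one_ne_zero
  obtain ⟨y, hy1, hy2⟩ := hcommon (-1) (by norm_num)
  exact ((hconv _ _).union x hx1 hx2 (hconv _ _)).union y (.inr hy2) hy1 (hconv _ _)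

namespace SimplePolygon

variable {P : SimplePolygon}

/-- If a straight line arrives at `v` along the boundary and leaves it off the boundary, then
`v` is a vertex and the line arrives along an edge. -/
theorem exists_vertex_of_eventually {v d : E2}
    (hL : ∀ᶠ s in nhdsWithin (0 : ℝ) (Ioi 0), v - s • d ∈ P.boundary)
    (hI : ∀ᶠ s in nhdsWithin (0 : ℝ) (Ioi 0), v + s • d ∉ P.boundary) :
    ∃ i j : ZMod P.n, (j = i + 1 ∨ j = i - 1) ∧ v = P.vtx i ∧
      ∃ c : ℝ, 0 < c ∧ d = c • (P.vtx i - P.vtx j) := by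
  obtain ⟨k, hk⟩ : ∃ k, ∃ᶠ s in nhdsWithin (0 : ℝ) (Ioi 0), v - s • d ∈ P.edge k := by
    by_contra! hcon
    obtain ⟨s, hs1, hs2⟩ := (hL.and (Filter.eventually_all.2 hcon)).exists
    obtain ⟨k, hk⟩ := mem_iUnion.1 hs1
    exact hs2 k hk
  have hvk : v ∈ P.edge k := by
    refine (P.isClosed_edge k).mem_of_frequently_of_tendsto hk ?_
    simpa only [smul_neg, ← sub_eq_add_neg] using tendsto_add_smul v (-d)
  obtain ⟨s, hs, hs0⟩ := (hk.and_eventually self_mem_nhdsWithin).exists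
  have hs0' : (0 : ℝ) < s := hs0
  obtain ⟨a, ha, hva⟩ := P.mem_edge_iff.1 hvk
  obtain ⟨b, hb, hsb⟩ := P.mem_edge_iff.1 hs
  have hd : d = ((a - b) / s) • P.dir k := by
    have h1 : s • d = (a - b) • P.dir k := by
      rw [show s • d = v - (v - s • d) by abel, hsb, hva]
      simp only [pointNear]
      module
    rw [div_eq_inv_mul, mul_smul, ← h1, smul_smul, inv_mul_cancel₀ hs0'.ne', one_smul]
  have hstay : ¬ ∀ᶠ s' in nhdsWithin (0 : ℝ) (Ioi 0), a + s' * ((a - b) / s) ∈ Icc (0 : ℝ) 1 := by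
    intro h
    obtain ⟨s', h1, h2⟩ := (h.and hI).exists
    refine h2 (P.edge_subset_boundary k (P.mem_edge_iff.2 ⟨_, h1, ?_⟩))
    rw [hd, hva]
    simp only [pointNear]
    module
  have hpos : ∀ x y : ℝ, 0 < x → ∀ᶠ s' in nhdsWithin (0 : ℝ) (Ioi 0), 0 < x + s' * y :=
    fun x y hx => eventually_pos_of_pos (f := fun s' => x + s' * y) (by fun_prop) (by simpa)
  rcases ha.1.eq_or_lt with h0 | h0
  · subst h0
    have hb0 : 0 < b := by
      rcases hb.1.eq_or_lt with h | h
      · subst h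
        exact absurd (by simp) hstay
      · exact h
    refine ⟨k, k + 1, .inl rfl, by simpa [pointNear] using hva, b / s, by positivity, ?_⟩
    rw [hd, dir]
    module
  rcases ha.2.eq_or_lt with h1 | h1
  · subst h1
    have hb1 : b < 1 := by
      rcases hb.2.eq_or_lt with h | h
      · subst h
        exact absurd (by simp) hstay
      · exact h
    refine ⟨k + 1, k, .inr (by ring), by simpa [pointNear, dir] using hva, (1 - b) / s,
      div_pos (by linarith) hs0', hd⟩
  · refine absurd ?_ hstay
    filter_upwards [hpos a ((a - b) / s) h0, hpos (1 - a) (-((a - b) / s)) (by linarith)]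
      with s' h2 h3
    exact ⟨h2.le, by linarith⟩

variable {R : SimplePolygon}

theorem exists_pocket_ssubset_of_w_notMem_boundary (hR : R.region = P.core) (C' : R.Cut)
    (hw : C'.w ∉ P.boundary) :
    ∃ C : P.Cut, C.Nonredundant ∧ C.pocket ⊂ P.pocketOfSeg C'.seg C'.u := by
  have hRP : R.region ⊆ P.region := hR ▸ P.core_subset_region
  obtain ⟨C, hC, hwC⟩ := (P.mem_boundary_or_mem_seg_of_mem_boundary_core hR
    C'.w_mem_boundary).resolve_left hw
  have hwi := P.mem_interior_region (C.seg_subset_region hwC) hw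
  obtain ⟨r₀, hr₀, hball₀⟩ := Metric.isOpen_iff.1 isOpen_interior _ hwi
  have hnorm : 0 < C'.t * ‖C'.v - C'.u‖ :=
    mul_pos C'.t_pos (norm_pos_iff.2 C'.v_sub_u_ne_zero)
  set r := min r₀ (C'.t * ‖C'.v - C'.u‖) with hrdef
  have hr : 0 < r := lt_min hr₀ hnorm
  have hpre := isPreconnected_ball_diff_segment (v := C'.v) C'.v_sub_u_ne_zero C'.t_pos hr
    (min_le_right _ _)
  rw [← C'.seg_eq, ← C'.w_eq] at hpre
  have hsub : Metric.ball C'.w r \ C'.seg ⊆ P.region \ C'.seg := fun x hx =>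
    ⟨interior_subset (hball₀ (Metric.ball_subset_ball (min_le_left _ _) hx.1)), hx.2⟩
  obtain ⟨y, hyb, hyA⟩ := mem_closure_iff.1
    (C'.seg_subset_closure_component hRP (right_mem_segment _ _ _)) _ Metric.isOpen_ball
    (Metric.mem_ball_self hr)
  have hA : Metric.ball C'.w r \ C'.seg ⊆ connectedComponentIn (P.region \ C'.seg) C'.u := by
    rw [connectedComponentIn_eq hyA]
    exact hpre.subset_connectedComponentIn ⟨hyb, (connectedComponentIn_subset _ _ hyA).2⟩ hsub
  obtain ⟨δ, hδ, hδr⟩ := exists_mem_Ioo_mul_lt hr ‖C.v - C'.w‖ (norm_nonneg _)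
  have hzb : C'.w + δ • (C.v - C'.w) ∈ Metric.ball C'.w r := by
    rw [mem_ball_iff_norm, add_sub_cancel_left, norm_smul, Real.norm_of_nonneg hδ.1.le]
    exact hδr
  have hzC : C'.w + δ • (C.v - C'.w) ∈ C.seg :=
    (convex_segment _ _).add_smul_sub_mem hwC (left_mem_segment _ _ _) ⟨hδ.1.le, hδ.2.le⟩
  refine ⟨C, hC, pocket_ssubset_of_meets hR C' hC hzC (hA ⟨hzb, fun hzs => ?_⟩)⟩
  obtain ⟨s, hs, hzeq⟩ := C'.mem_seg_iff.1 hzs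
  rcases hs.1.eq_or_lt with h0 | h0
  · rw [hzeq, ← h0, zero_smul, add_zero, mem_ball_iff_norm, C'.w_eq, sub_add_cancel_left,
      norm_neg, norm_smul, Real.norm_of_nonneg C'.t_pos.le] at hzb
    exact (hzb.trans_le (min_le_right _ _)).false
  rcases hs.2.eq_or_lt with h1 | h1
  · rw [h1, ← C'.w_eq, add_eq_left, smul_eq_zero] at hzeq
    rcases hzeq with h | h
    · exact hδ.1.ne' h
    · exact hw (sub_eq_zero.1 h ▸ C.v_mem_boundary)
  · have hzi := C'.add_smul_mem_interior ⟨h0, h1⟩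
    rw [← hzeq, hR] at hzi
    exact Cut.notMem_pocket_of_mem_interior_core hC hzi (C.seg_subset_pocket hzC)

/-- A cut of the core that runs along the boundary of `P` is a cut of `P`. -/
theorem exists_cut_pocket_eq (hR : R.region = P.core) (C' : R.Cut) (hw : C'.w ∈ P.boundary)
    (hL : ∀ s ∈ Ioc (0 : ℝ) 1, C'.v - s • (C'.v - C'.u) ∈ P.boundary) :
    ∃ C : P.Cut, C.pocket = P.pocketOfSeg C'.seg C'.u := by
  have hRP : R.region ⊆ P.region := hR ▸ P.core_subset_region
  have hinter : ∀ s ∈ Ioo (0 : ℝ) C'.t, C'.v + s • (C'.v - C'.u) ∈ interior P.region :=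
    fun s hs => interior_mono hRP (C'.add_smul_mem_interior hs)
  obtain ⟨i, j, hij, hv, c, hc, hd⟩ := exists_vertex_of_eventually (P := P)
    (Filter.eventually_of_mem (Ioc_mem_nhdsGT one_pos) hL)
    (Filter.eventually_of_mem (Ioo_mem_nhdsGT C'.t_pos) fun s hs =>
      P.notMem_boundary_of_mem_interior (hinter s hs))
  have hdiv : ∀ s : ℝ, s • (P.vtx i - P.vtx j) = (s / c) • (C'.v - C'.u) := by
    intro s
    rw [hd, smul_smul, div_mul_cancel₀ _ hc.ne']
  have hIoo : ∀ s ∈ Ioo (0 : ℝ) (C'.t * c), s / c ∈ Ioo (0 : ℝ) C'.t := fun s hs =>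
    ⟨div_pos hs.1 hc, (div_lt_iff₀ hc).2 hs.2⟩
  have hwi : P.vtx i + (C'.t * c) • (P.vtx i - P.vtx j) = C'.w := by
    rw [hdiv, mul_div_cancel_right₀ _ hc.ne', ← hv, C'.w_eq]
  have hmem : ∀ s ∈ Ioo (0 : ℝ) (C'.t * c),
      P.vtx i + s • (P.vtx i - P.vtx j) ∈ interior P.region := by
    intro s hs
    rw [hdiv, ← hv]
    exact hinter _ (hIoo s hs)
  let C : P.Cut :=
    { i := i
      j := j
      adj := hij
      reflex := P.isReflex_of_eventually_mem_interior hij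
        (Filter.eventually_of_mem (Ioo_mem_nhdsGT (mul_pos C'.t_pos hc)) hmem)
      t := C'.t * c
      t_pos := mul_pos C'.t_pos hc
      hits := hwi ▸ hw
      first_hit := fun s hs => P.notMem_boundary_of_mem_interior (hmem s hs)
      inside := by
        rw [hwi, ← hv]
        exact C'.seg_subset_region.trans hRP }
  have hseg : C.seg = C'.seg := by
    change segment ℝ (P.vtx i) (P.vtx i + (C'.t * c) • (P.vtx i - P.vtx j)) = _
    rw [hwi, ← hv]
    rfl
  refine ⟨C, ?_⟩
  have h1 := C.sub_smul_mem_component_of_subset subset_rfl (s := min 1 c)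
    ⟨lt_min one_pos hc, min_le_left _ _⟩
  have h2 := C'.sub_smul_mem_component_of_subset hRP (s := min 1 c / c)
    ⟨div_pos (lt_min one_pos hc) hc, (div_le_one hc).2 (min_le_right _ _)⟩
  have hpt : C.v - min 1 c • (C.v - C.u) = C'.v - (min 1 c / c) • (C'.v - C'.u) := by
    rw [← hdiv, hv]
    rfl
  rw [hpt, hseg] at h1
  unfold Cut.pocket pocketOfSeg
  rw [hseg, connectedComponentIn_eq h1, connectedComponentIn_eq h2]

end SimplePolygon

/-- Let `Q = P.core` be the subpolygon of `P` obtained by cutting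
along all nonredundant cuts, realized as a simple polygon `R`.  Then the pocket in `P`
of every cut of `R` strictly contains the pocket of some nonredundant cut of `P`;
in particular every cut of `Q` is redundant when regarded as a cut of `P`. -/
theorem core_cuts_are_redundant_in_P
    (P : SimplePolygon) (R : SimplePolygon) (hR : R.region = P.core)
    (C' : R.Cut) :
    ∃ C : P.Cut, C.Nonredundant ∧ C.pocket ⊂ P.pocketOfSeg C'.seg C'.u := by
  have hRP : R.region ⊆ P.region := hR ▸ P.core_subset_region
  by_cases hseg : ∃ C : P.Cut, C.Nonredundant ∧
      ∃ s ∈ Ioc (0 : ℝ) 1, C'.v - s • (C'.v - C'.u) ∈ C.seg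
  · obtain ⟨C, hC, s, hs, hsC⟩ := hseg
    exact ⟨C, hC, SimplePolygon.pocket_ssubset_of_meets hR C' hC hsC
      (C'.sub_smul_mem_component_of_subset hRP hs)⟩
  by_cases hw : C'.w ∈ P.boundary
  · obtain ⟨C, hC⟩ := SimplePolygon.exists_cut_pocket_eq hR C' hw fun s hs =>
      (P.mem_boundary_or_mem_seg_of_mem_boundary_core hR
        (C'.sub_smul_mem_boundary hs)).resolve_right
        fun ⟨C, hC, hsC⟩ => hseg ⟨C, hC, s, hs, hsC⟩
    have hred : C.Redundant := by
      by_contra hnon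
      obtain ⟨z, hz, hzi⟩ := C'.component_inter_interior_nonempty hRP
      rw [hR] at hzi
      refine SimplePolygon.Cut.notMem_pocket_of_mem_interior_core hnon hzi ?_
      rw [hC]
      exact .inl (subset_closure hz)
    obtain ⟨D, hD⟩ := hred
    obtain ⟨C₀, hC₀, hsub⟩ := D.exists_nonredundant_pocket_subset
    exact ⟨C₀, hC₀, hC ▸ hsub.trans_ssubset hD⟩
  · exact SimplePolygon.exists_pocket_ssubset_of_w_notMem_boundary hR C' hw
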